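/- arXiv:0807.3520 — 9 statements merged into one kernel-verified Lean document; each statement's English description precedes it below -/
import Mathlib

section
/- Let A ∈ ℝ^{m×n} (m < n) satisfy the nullspace property of order k with constant C, where 0 < C < 2. Then for every x ∈ ℝ^n and every minimizer x̂ of ‖z‖₁ over the set {z ∈ ℝ^n : Az = Ax}, one has ‖x − x̂‖₁ ≤ (2C/(2 − C)) · σ_k(x). -/
/-- `σ_k(x)`: the ℓ1 error of the best k-term approximation of `x`,
`σ_k(x) = inf {‖x − z‖₁ : z has at most k nonzero entries}`. -/
noncomputable def sigmaK {n : ℕ} (k : ℕ) (x : Fin n → ℝ) : ℝ :=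
  sInf {r : ℝ | ∃ z : Fin n → ℝ, {i | z i ≠ 0}.ncard ≤ k ∧ r = ∑ i, |x i - z i|}

/-- If `A ∈ ℝ^{m×n}` (m < n) satisfies the nullspace property of order `k` with constant `C`,
`0 < C < 2`, then every ℓ1-minimizer `x̂` over `{z : Az = Ax}` satisfies
`‖x − x̂‖₁ ≤ (2C/(2−C))·σ_k(x)`. -/
theorem stmt0 {m n k : ℕ} (hmn : m < n) (hk1 : 1 ≤ k) (hkn : k ≤ n)
    (A : Matrix (Fin m) (Fin n) ℝ) (C : ℝ) (hC0 : 0 < C) (hC2 : C < 2)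
    (hNSP : ∀ (z : Fin n → ℝ) (T : Finset (Fin n)), A.mulVec z = 0 → T.card ≤ k →
      (∑ i, |z i|) ≤ C * ∑ i ∈ Tᶜ, |z i|)
    (x xhat : Fin n → ℝ)
    (hfeas : A.mulVec xhat = A.mulVec x)
    (hmin : ∀ z : Fin n → ℝ, A.mulVec z = A.mulVec x → (∑ i, |xhat i|) ≤ ∑ i, |z i|) :
    (∑ i, |x i - xhat i|) ≤ (2 * C / (2 - C)) * sigmaK k x := by
  have hpos : 0 < 2 * C / (2 - C) := div_pos (by linarith) (by linarith)
  rw [← div_le_iff₀' hpos]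
  unfold sigmaK
  refine le_csInf ⟨_, 0, by simp, rfl⟩ ?_
  rintro r ⟨z, hz, rfl⟩
  classical
  set S : Finset (Fin n) := Finset.univ.filter (fun i => z i ≠ 0) with hS
  have hcard : S.card ≤ k := by
    have h : {i | z i ≠ 0} = (S : Set (Fin n)) := by ext i; simp [hS]
    rwa [h, Set.ncard_coe_finset] at hz
  have h0 : A.mulVec (x - xhat) = 0 := by rw [Matrix.mulVec_sub, hfeas, sub_self]
  have h1 := hNSP (x - xhat) S h0 hcard
  simp only [Pi.sub_apply] at h1
  have h2 := hmin x rfl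
  have e1 := Finset.sum_add_sum_compl S (fun i => |x i|)
  have e2 := Finset.sum_add_sum_compl S (fun i => |xhat i|)
  have e3 := Finset.sum_add_sum_compl S (fun i => |x i - xhat i|)
  have e4 := Finset.sum_add_sum_compl S (fun i => |x i - z i|)
  have h3 : ∑ i ∈ S, |x i| ≤ ∑ i ∈ S, |xhat i| + ∑ i ∈ S, |x i - xhat i| := by
    rw [← Finset.sum_add_distrib]
    refine Finset.sum_le_sum fun i _ => ?_
    linarith [abs_sub_abs_le_abs_sub (x i) (xhat i)]
  have h4 : ∑ i ∈ Sᶜ, |x i - xhat i| ≤ ∑ i ∈ Sᶜ, |x i| + ∑ i ∈ Sᶜ, |xhat i| := by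
    rw [← Finset.sum_add_distrib]
    exact Finset.sum_le_sum fun i _ => abs_sub (x i) (xhat i)
  have h5 : ∑ i ∈ Sᶜ, |x i - z i| = ∑ i ∈ Sᶜ, |x i| := by
    refine Finset.sum_congr rfl fun i hi => ?_
    have : z i = 0 := by simpa [hS] using hi
    rw [this, sub_zero]
  have h6 : 0 ≤ ∑ i ∈ S, |x i - z i| := Finset.sum_nonneg fun i _ => abs_nonneg _
  rw [div_le_iff₀' hpos, div_mul_eq_mul_div, le_div_iff₀ (by linarith)]
  have h7 : 2 * ∑ i ∈ Sᶜ, |x i - xhat i| ≤ ∑ i, |x i - xhat i| + 2 * ∑ i, |x i - z i| := by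
    linarith
  have h8 := mul_le_mul_of_nonneg_left h7 hC0.le
  linarith
end

section
/- Let A ∈ ℝ^{m×n} satisfy the nullspace property of order 2k with constant C/2, where C > 0. Then there exists a decoder, i.e. a map Δ : ℝ^m → ℝ^n, such that ‖x − Δ(Ax)‖₁ ≤ C · σ_k(x) for every x ∈ ℝ^n. -/
lemma aux_sigma {n : ℕ} (k : ℕ) : ∃ (F : Finset (Finset (Fin n))) (hF : F.Nonempty),
    (∀ T ∈ F, T.card ≤ k) ∧
    ∀ x : Fin n → ℝ, sigmaK k x = F.inf' hF (fun T => ∑ i ∈ Tᶜ, |x i|) := by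
  classical
  refine ⟨Finset.univ.filter (fun T => T.card ≤ k), ⟨∅, by simp⟩, by simp, fun x => ?_⟩
  unfold sigmaK
  apply le_antisymm
  · apply Finset.le_inf'
    intro T hT
    have hT : T.card ≤ k := by simpa using hT
    apply csInf_le
    · refine ⟨0, ?_⟩
      rintro r ⟨z, -, rfl⟩
      positivity
    · refine ⟨fun i => if i ∈ T then x i else 0, ?_, ?_⟩
      · refine le_trans ?_ hT
        rw [← Set.ncard_coe_finset T]
        apply Set.ncard_le_ncard _ (Finset.finite_toSet T)
        intro i hi
        by_contra h
        simp at h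
        simp [h] at hi
      · rw [← Finset.sum_add_sum_compl T (fun i => |x i - if i ∈ T then x i else 0|)]
        rw [Finset.sum_eq_zero (s := T), zero_add]
        · apply Finset.sum_congr rfl
          intro i hi
          simp at hi
          simp [hi]
        · intro i hi
          simp [hi]
  · apply le_csInf
    · exact ⟨_, 0, by simp, rfl⟩
    · rintro r ⟨z, hz, rfl⟩
      have hc : (Finset.univ.filter (fun i => z i ≠ 0)).card ≤ k := by
        rw [← Set.ncard_coe_finset]
        simpa using hz
      refine (Finset.inf'_le _ (b := Finset.univ.filter (fun i => z i ≠ 0))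
        (by simpa using hc)).trans ?_
      calc _ = ∑ i ∈ (Finset.univ.filter (fun i => z i ≠ 0))ᶜ, |x i - z i| := by
            apply Finset.sum_congr rfl
            intro i hi
            simp at hi
            simp [hi]
        _ ≤ _ := Finset.sum_le_sum_of_subset_of_nonneg (Finset.subset_univ _)
            (fun _ _ _ => abs_nonneg _)

/-- If `A` satisfies the nullspace property of order `2k` with constant `C/2` (`C > 0`), then
there exists a decoder `Δ : ℝ^m → ℝ^n` with `‖x − Δ(Ax)‖₁ ≤ C·σ_k(x)` for every `x`. -/
theorem stmt1 {m n k : ℕ} (hk1 : 1 ≤ k) (hkn : 2 * k ≤ n)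
    (A : Matrix (Fin m) (Fin n) ℝ) (C : ℝ) (hC : 0 < C)
    (hNSP : ∀ (z : Fin n → ℝ) (T : Finset (Fin n)), A.mulVec z = 0 → T.card ≤ 2 * k →
      (∑ i, |z i|) ≤ (C / 2) * ∑ i ∈ Tᶜ, |z i|) :
    ∃ Δ : (Fin m → ℝ) → (Fin n → ℝ),
      ∀ x : Fin n → ℝ, (∑ i, |x i - Δ (A.mulVec x) i|) ≤ C * sigmaK k x := by
  classical
  obtain ⟨F, hF, hFk, hs⟩ := aux_sigma (n := n) k
  have hcont : Continuous (fun x : Fin n → ℝ => sigmaK k x) := by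
    simp only [hs]
    apply Continuous.finset_inf'_apply
    intro T _
    fun_prop
  have hex : ∀ x : Fin n → ℝ, ∃ T : Finset (Fin n), T.card ≤ k ∧
      sigmaK k x = ∑ i ∈ Tᶜ, |x i| := by
    intro x
    obtain ⟨T, hT, h⟩ := Finset.exists_mem_eq_inf' hF (fun T => ∑ i ∈ Tᶜ, |x i|)
    exact ⟨T, hFk T hT, (hs x).trans h⟩
  have key : ∀ x y : Fin n → ℝ, A.mulVec x = A.mulVec y →
      (∑ i, |x i - y i|) ≤ C / 2 * (sigmaK k x + sigmaK k y) := by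
    intro x y hxy
    obtain ⟨T, hT, hx⟩ := hex x
    obtain ⟨S, hS, hy⟩ := hex y
    have h := hNSP (x - y) (T ∪ S) (by rw [Matrix.mulVec_sub, hxy, sub_self])
      ((Finset.card_union_le _ _).trans (by omega))
    refine h.trans (mul_le_mul_of_nonneg_left ?_ (by positivity))
    rw [hx, hy]
    calc _ ≤ ∑ i ∈ (T ∪ S)ᶜ, (|x i| + |y i|) :=
          Finset.sum_le_sum (fun i _ => abs_sub _ _)
      _ = ∑ i ∈ (T ∪ S)ᶜ, |x i| + ∑ i ∈ (T ∪ S)ᶜ, |y i| := Finset.sum_add_distrib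
      _ ≤ _ := by
          apply add_le_add
          · apply Finset.sum_le_sum_of_subset_of_nonneg
            · exact Finset.compl_subset_compl.2 Finset.subset_union_left
            · exact fun _ _ _ => abs_nonneg _
          · apply Finset.sum_le_sum_of_subset_of_nonneg
            · exact Finset.compl_subset_compl.2 Finset.subset_union_right
            · exact fun _ _ _ => abs_nonneg _
  have hmin : ∀ v : Fin m → ℝ, ∃ y : Fin n → ℝ, ∀ x : Fin n → ℝ, A.mulVec x = v →
      A.mulVec y = v ∧ sigmaK k y ≤ sigmaK k x := by
    intro v
    by_cases hv : ∃ x₀, A.mulVec x₀ = v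
    · obtain ⟨x₀, hx₀⟩ := hv
      have hσ : ∀ x : Fin n → ℝ, 0 ≤ sigmaK k x := by
        intro x
        obtain ⟨T, -, h⟩ := hex x
        rw [h]; positivity
      have hcomp : IsCompact ({x : Fin n → ℝ | A.mulVec x = v} ∩
          Metric.closedBall x₀ (C * sigmaK k x₀)) := by
        apply IsCompact.inter_left (isCompact_closedBall _ _)
        apply isClosed_eq _ continuous_const
        exact Continuous.matrix_mulVec continuous_const continuous_id
      have hx₀m : x₀ ∈ ({x : Fin n → ℝ | A.mulVec x = v} ∩
          Metric.closedBall x₀ (C * sigmaK k x₀)) :=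
        ⟨hx₀, Metric.mem_closedBall_self (mul_nonneg hC.le (hσ _))⟩
      obtain ⟨y, hy, hymin⟩ := hcomp.exists_isMinOn ⟨x₀, hx₀m⟩ hcont.continuousOn
      refine ⟨y, fun x hx => ⟨hy.1, ?_⟩⟩
      rcases le_total (sigmaK k x) (sigmaK k x₀) with h | h
      · refine hymin ⟨hx, ?_⟩
        rw [Metric.mem_closedBall, dist_pi_le_iff (mul_nonneg hC.le (hσ _))]
        intro i
        rw [Real.dist_eq]
        have h1 := key x x₀ (hx.trans hx₀.symm)
        have h2 : |x i - x₀ i| ≤ ∑ i, |x i - x₀ i| :=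
          Finset.single_le_sum (f := fun i => |x i - x₀ i|)
            (fun _ _ => abs_nonneg _) (Finset.mem_univ i)
        nlinarith
      · exact le_trans (hymin hx₀m) h
    · exact ⟨0, fun x hx => absurd ⟨x, hx⟩ hv⟩
  choose Δ hΔ using hmin
  refine ⟨Δ, fun x => ?_⟩
  obtain ⟨h1, h2⟩ := hΔ _ x rfl
  have h3 := key x _ h1.symm
  nlinarith
end

section
/- Let A ∈ ℝ^{m×n}, C > 0, and suppose some map Δ : ℝ^m → ℝ^n satisfies ‖x − Δ(Ax)‖₁ ≤ C · σ_k(x) for every x ∈ ℝ^n. Then A satisfies the nullspace property of order 2k with constant C, i.e. ‖z‖₁ ≤ C · ‖z_{T^c}‖₁ for every z with Az = 0 and every T with |T| ≤ 2k. -/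
theorem sigmaK_le_aux {n k : ℕ} (x : Fin n → ℝ) (S : Finset (Fin n)) (hS : S.card ≤ k) :
    sigmaK k x ≤ ∑ i, |x i - (if i ∈ S then x i else 0)| := by
  unfold sigmaK
  apply csInf_le
  · refine ⟨0, ?_⟩
    rintro r ⟨z, -, rfl⟩
    positivity
  · refine ⟨fun i => if i ∈ S then x i else 0, ?_, rfl⟩
    refine le_trans ?_ hS
    rw [← Set.ncard_coe_finset S]
    apply Set.ncard_le_ncard
    · intro i hi
      by_contra h
      simp at h
      simp [h] at hi
    · exact S.finite_toSet

/-- If some decoder `Δ : ℝ^m → ℝ^n` satisfies `‖x − Δ(Ax)‖₁ ≤ C·σ_k(x)` for all `x`, then `A`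
satisfies the nullspace property of order `2k` with constant `C`. -/
theorem stmt2 {m n k : ℕ} (hk1 : 1 ≤ k) (hkn : 2 * k ≤ n)
    (A : Matrix (Fin m) (Fin n) ℝ) (C : ℝ) (hC : 0 < C)
    (Δ : (Fin m → ℝ) → (Fin n → ℝ))
    (hΔ : ∀ x : Fin n → ℝ, (∑ i, |x i - Δ (A.mulVec x) i|) ≤ C * sigmaK k x) :
    ∀ (z : Fin n → ℝ) (T : Finset (Fin n)), A.mulVec z = 0 → T.card ≤ 2 * k →
      (∑ i, |z i|) ≤ C * ∑ i ∈ Tᶜ, |z i| := by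
  intro z T hz hT
  obtain ⟨S, hST, hS⟩ := Finset.exists_subset_card_eq (Nat.min_le_right k T.card)
  have hSk : S.card ≤ k := by omega
  have hU : (T \ S).card ≤ k := by
    rw [Finset.card_sdiff_of_subset hST]; omega
  set x : Fin n → ℝ := fun i => if i ∈ S then - z i else 0 with hx
  have hAx : A.mulVec (x + z) = A.mulVec x := by rw [Matrix.mulVec_add, hz, add_zero]
  have h1 := (hΔ x).trans (mul_le_mul_of_nonneg_left (sigmaK_le_aux x S hSk) hC.le)
  have h0 : ∑ i, |x i - (if i ∈ S then x i else 0)| = 0 := by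
    apply Finset.sum_eq_zero
    intro i _
    by_cases h : i ∈ S <;> simp [hx, h]
  rw [h0, mul_zero] at h1
  have h2 : ∀ i, Δ (A.mulVec x) i = x i := by
    intro i
    have := (Finset.sum_eq_zero_iff_of_nonneg (fun i _ => abs_nonneg _)).1
      (le_antisymm h1 (Finset.sum_nonneg fun i _ => abs_nonneg _)) i (Finset.mem_univ i)
    rw [abs_eq_zero] at this
    linarith
  have h3 := (hΔ (x + z)).trans
    (mul_le_mul_of_nonneg_left (sigmaK_le_aux (x + z) (T \ S) hU) hC.le)
  rw [hAx] at h3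
  have h4 : ∑ i, |(x + z) i - Δ (A.mulVec x) i| = ∑ i, |z i| := by
    apply Finset.sum_congr rfl
    intro i _
    rw [h2]; simp
  have h5 : ∑ i, |(x + z) i - (if i ∈ T \ S then (x + z) i else 0)| = ∑ i ∈ Tᶜ, |z i| := by
    rw [← Finset.sum_subset (Finset.subset_univ Tᶜ)]
    · apply Finset.sum_congr rfl
      intro i hi
      have hT' : i ∉ T := by simpa using hi
      have hS' : i ∉ S := fun h => hT' (hST h)
      simp [hx, hT', hS']
    · intro i _ hi
      have hT' : i ∈ T := by simpa using hi
      by_cases h : i ∈ S <;> simp [hx, h, hT']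
  rwa [h4, h5] at h3
end

section
/- Let A ∈ ℝ^{m×n} and let k be an integer with 1 ≤ k ≤ n. Suppose that for every nonzero z ∈ ℝ^n with Az = 0 and every index set T ⊆ {1,…,n} with |T| ≤ k one has ‖z_T‖₁ < (1/2)·‖z‖₁ (i.e. α_k(A) < 1/2 holds pointwise on the nullspace). Then for every x₀ ∈ ℝ^n with at most k nonzero entries, x₀ is the unique minimizer of ‖x‖₁ over {x ∈ ℝ^n : Ax = Ax₀}. -/
/-- If `‖z_T‖₁ < (1/2)·‖z‖₁` for every nonzero `z` in the nullspace of `A` and every `T` with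
`|T| ≤ k`, then every `x₀` with at most `k` nonzero entries is the unique ℓ1-norm minimizer
over `{x : Ax = Ax₀}`. -/
theorem stmt3 {m n k : ℕ} (hk1 : 1 ≤ k) (hkn : k ≤ n) (A : Matrix (Fin m) (Fin n) ℝ)
    (h : ∀ z : Fin n → ℝ, z ≠ 0 → A.mulVec z = 0 →
      ∀ T : Finset (Fin n), T.card ≤ k → (∑ i ∈ T, |z i|) < (1 / 2) * ∑ i, |z i|) :
    ∀ x₀ : Fin n → ℝ, {i | x₀ i ≠ 0}.ncard ≤ k →
      ∀ x : Fin n → ℝ, A.mulVec x = A.mulVec x₀ → x ≠ x₀ →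
        (∑ i, |x₀ i|) < ∑ i, |x i| := by
  intro x₀ hx₀ x hx hne
  classical
  have hcard : (Finset.univ.filter (fun i => x₀ i ≠ 0)).card ≤ k := by
    rw [← Set.ncard_coe_finset]
    simpa using hx₀
  have h1 := h (x - x₀) (sub_ne_zero.mpr hne)
    (by rw [Matrix.mulVec_sub, hx, sub_self]) _ hcard
  rw [Finset.sum_filter] at h1
  have h2 : ∑ i, (|x₀ i| + |(x - x₀) i| - 2 * (if x₀ i ≠ 0 then |(x - x₀) i| else 0))
      ≤ ∑ i, |x i| := by
    apply Finset.sum_le_sum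
    intro i _
    by_cases hi : x₀ i = 0
    · simp [hi]
    · have h3 := abs_sub_abs_le_abs_sub (x₀ i) (x i)
      rw [abs_sub_comm] at h3
      simp only [ne_eq, hi, not_false_eq_true, if_true, Pi.sub_apply]
      linarith
  rw [Finset.sum_sub_distrib, Finset.sum_add_distrib, ← Finset.mul_sum] at h2
  linarith
end

section
/- Let x ∈ ℝ^n and let k be an integer with 1 ≤ k ≤ n. Then sup{ yᵀx : y ∈ ℝ^n, ‖y‖_∞ ≤ 1, ‖y‖₁ ≤ k } = max{ Σ_{i∈T} |x_i| : T ⊆ {1,…,n}, |T| = k }, i.e. the maximum of yᵀx over the set {‖y‖_∞ ≤ 1, ‖y‖₁ ≤ k} equals the sum of the k largest absolute values of the entries of x. -/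
/-- The maximum of `yᵀx` over `{y : ‖y‖_∞ ≤ 1, ‖y‖₁ ≤ k}` equals the sum of the `k` largest
absolute values of the entries of `x`. -/
theorem stmt5 {n : ℕ} (hn : 1 ≤ n) (x : Fin n → ℝ) (k : ℕ) (hk1 : 1 ≤ k) (hkn : k ≤ n) :
    sSup {r : ℝ | ∃ y : Fin n → ℝ,
        (∀ i, |y i| ≤ 1) ∧ (∑ i, |y i|) ≤ (k : ℝ) ∧ r = ∑ i, y i * x i} =
      sSup {r : ℝ | ∃ T : Finset (Fin n), T.card = k ∧ r = ∑ i ∈ T, |x i|} := by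
  have hne : (Finset.powersetCard k (Finset.univ : Finset (Fin n))).Nonempty := by
    rw [Finset.powersetCard_nonempty]; simpa using hkn
  obtain ⟨T, hT, hmax⟩ := Finset.exists_max_image _ (fun T => ∑ i ∈ T, |x i|) hne
  have hTc : T.card = k := (Finset.mem_powersetCard.mp hT).2
  have hTne : T.Nonempty := Finset.card_pos.mp (by omega)
  obtain ⟨m, hm, hmin⟩ := Finset.exists_min_image T (fun i => |x i|) hTne
  have hout : ∀ j, j ∉ T → |x j| ≤ |x m| := by
    intro j hj
    have hj' : j ∉ T.erase m := fun h => hj (Finset.mem_of_mem_erase h)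
    have h1 := hmax (insert j (T.erase m)) (by
      rw [Finset.mem_powersetCard]
      refine ⟨Finset.subset_univ _, ?_⟩
      rw [Finset.card_insert_of_notMem hj', Finset.card_erase_of_mem hm]; omega)
    rw [Finset.sum_insert hj'] at h1
    have h2 := Finset.add_sum_erase T (fun i => |x i|) hm
    linarith
  have hR : IsGreatest {r : ℝ | ∃ T : Finset (Fin n), T.card = k ∧ r = ∑ i ∈ T, |x i|}
      (∑ i ∈ T, |x i|) := by
    refine ⟨⟨T, hTc, rfl⟩, ?_⟩
    rintro r ⟨S, hS, rfl⟩
    exact hmax S (Finset.mem_powersetCard.mpr ⟨Finset.subset_univ _, hS⟩)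
  have hL : IsGreatest {r : ℝ | ∃ y : Fin n → ℝ,
        (∀ i, |y i| ≤ 1) ∧ (∑ i, |y i|) ≤ (k : ℝ) ∧ r = ∑ i, y i * x i}
      (∑ i ∈ T, |x i|) := by
    constructor
    · have hs : ∀ a : ℝ, |if 0 ≤ a then (1:ℝ) else -1| = 1 := by
        intro a; split_ifs <;> simp
      refine ⟨fun i => if i ∈ T then (if 0 ≤ x i then 1 else -1) else 0, ?_, ?_, ?_⟩
      · intro i
        by_cases h : i ∈ T
        · simp only [h, if_true, hs, le_refl]
        · simp [h]
      · have : ∀ i, |if i ∈ T then (if 0 ≤ x i then (1:ℝ) else -1) else 0|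
            = if i ∈ T then 1 else 0 := by
          intro i
          by_cases h : i ∈ T
          · simp only [h, if_true, hs]
          · simp [h]
        simp only [this]
        simp [hTc]
      · simp only [ite_mul, zero_mul, Finset.sum_ite_mem, Finset.univ_inter]
        refine Finset.sum_congr rfl fun i _ => ?_
        split_ifs with h
        · rw [abs_of_nonneg h, one_mul]
        · rw [abs_of_neg (not_le.mp h)]; ring
    · rintro r ⟨y, hy, hyk, rfl⟩
      have h1 : ∀ i, y i * x i ≤ (if i ∈ T then |x i| - |x m| else 0) + |x m| * |y i| := by
        intro i
        have h0 : y i * x i ≤ |y i| * |x i| := by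
          rw [← abs_mul]; exact le_abs_self _
        by_cases h : i ∈ T
        · have := hmin i h
          simp only [h, if_true]
          nlinarith [hy i]
        · have := hout i h
          simp only [h, if_false]
          nlinarith [abs_nonneg (y i)]
      calc ∑ i, y i * x i ≤ ∑ i, ((if i ∈ T then |x i| - |x m| else 0) + |x m| * |y i|) :=
            Finset.sum_le_sum fun i _ => h1 i
        _ = ∑ i ∈ T, |x i| - k * |x m| + |x m| * ∑ i, |y i| := by
            rw [Finset.sum_add_distrib, ← Finset.mul_sum, Finset.sum_ite_mem,
              Finset.univ_inter, Finset.sum_sub_distrib, Finset.sum_const, hTc, nsmul_eq_mul]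
        _ ≤ _ := by nlinarith [abs_nonneg (x m)]
  rw [hL.csSup_eq, hR.csSup_eq]
end

section
/- Let A ∈ ℝ^{m×n}, k > 0, and let U₁, U₂, U₃, W ∈ ℝ^{n×n} be symmetric and U₄ ∈ ℝ^{n×n} be such that the block matrix [[U₁ − AᵀWA, −(I + U₄)/2],[−(I + U₄ᵀ)/2, U₂ + U₃]] is positive semidefinite. Then for every triple (X,Y,Z) feasible for SDP_k, Tr(Z) ≤ ‖U₁‖_∞ + k²·‖U₂‖_∞ + ‖U₃‖₁ + k·‖U₄‖_∞ (weak duality: any such dual feasible point yields an upper bound on the optimal value of SDP_k, hence on α_k(A)). -/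
/-- Feasibility for the semidefinite relaxation `SDP_k`. -/
def SDPFeasible {m n : ℕ} (A : Matrix (Fin m) (Fin n) ℝ) (k : ℝ)
    (X Y Z : Matrix (Fin n) (Fin n) ℝ) : Prop :=
  X.IsSymm ∧ Y.IsSymm ∧
  A * X * A.transpose = 0 ∧
  (∑ i, ∑ j, |X i j|) ≤ 1 ∧
  (∀ i j, |Y i j| ≤ 1) ∧
  (∑ i, ∑ j, |Y i j|) ≤ k ^ 2 ∧
  (∑ i, ∑ j, |Z i j|) ≤ k ∧
  (Matrix.fromBlocks X Z.transpose Z Y).PosSemidef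

theorem aux_trace_le {n : ℕ} (U V : Matrix (Fin n) (Fin n) ℝ) (c d : ℝ) (hc : 0 ≤ c)
    (hU : ∀ i j, |U i j| ≤ c) (hV : (∑ i, ∑ j, |V i j|) ≤ d) :
    |(U * V).trace| ≤ c * d := by
  have h1 : |(U * V).trace| ≤ ∑ i, ∑ j, |U i j| * |V j i| := by
    simp only [Matrix.trace, Matrix.diag, Matrix.mul_apply]
    refine (Finset.abs_sum_le_sum_abs _ _).trans (Finset.sum_le_sum fun i _ => ?_)
    refine (Finset.abs_sum_le_sum_abs _ _).trans (Finset.sum_le_sum fun j _ => ?_)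
    rw [abs_mul]
  have h2 : ∑ i, ∑ j, |U i j| * |V j i| ≤ ∑ i, ∑ j, c * |V j i| :=
    Finset.sum_le_sum fun i _ => Finset.sum_le_sum fun j _ =>
      mul_le_mul_of_nonneg_right (hU i j) (abs_nonneg _)
  have h3 : ∑ i, ∑ j, c * |V j i| = c * ∑ i, ∑ j, |V i j| := by
    rw [Finset.sum_comm]
    simp only [Finset.mul_sum]
  calc _ ≤ _ := h1
    _ ≤ _ := h2
    _ = _ := h3
    _ ≤ _ := mul_le_mul_of_nonneg_left hV hc

theorem aux_le_sup {n : ℕ} (U : Matrix (Fin n) (Fin n) ℝ) (i j : Fin n) :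
    |U i j| ≤ ⨆ i, ⨆ j, |U i j| :=
  (le_ciSup (f := fun j => |U i j|) (Set.finite_range _).bddAbove j).trans
    (le_ciSup (f := fun i => ⨆ j, |U i j|) (Set.finite_range _).bddAbove i)

theorem aux_sup_nonneg {n : ℕ} (U : Matrix (Fin n) (Fin n) ℝ) :
    0 ≤ ⨆ i, ⨆ j, |U i j| :=
  Real.iSup_nonneg fun _ => Real.iSup_nonneg fun _ => abs_nonneg _

theorem aux_tr {n : ℕ} (P Q R S : Matrix (Fin n) (Fin n) ℝ) :
    (Matrix.fromBlocks P Q R S).trace = P.trace + S.trace := by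
  simp [Matrix.trace, Fintype.sum_sum_type]

open scoped MatrixOrder in
theorem aux_psd {ι : Type*} [Fintype ι] [DecidableEq ι] (M P : Matrix ι ι ℝ)
    (hM : M.PosSemidef) (hP : P.PosSemidef) : 0 ≤ (M * P).trace := by
  obtain ⟨B, rfl⟩ := CStarAlgebra.nonneg_iff_eq_star_mul_self.mp hP.nonneg
  rw [← mul_assoc, Matrix.trace_mul_comm, ← mul_assoc]
  exact (hM.mul_mul_conjTranspose_same B).trace_nonneg

/-- Weak duality: if the dual block matrix
`[[U₁ − AᵀWA, −(I + U₄)/2],[−(I + U₄ᵀ)/2, U₂ + U₃]]` is positive semidefinite, then for any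
triple `(X,Y,Z)` feasible for `SDP_k`,
`Tr(Z) ≤ ‖U₁‖_∞ + k²·‖U₂‖_∞ + ‖U₃‖₁ + k·‖U₄‖_∞`. -/
theorem stmt7 {m n : ℕ} (A : Matrix (Fin m) (Fin n) ℝ) (k : ℝ) (hk : 0 < k)
    (U1 U2 U3 U4 : Matrix (Fin n) (Fin n) ℝ) (W : Matrix (Fin m) (Fin m) ℝ)
    (hU1 : U1.IsSymm) (hU2 : U2.IsSymm) (hU3 : U3.IsSymm) (hW : W.IsSymm)
    (hdual : (Matrix.fromBlocks (U1 - A.transpose * W * A)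
        (-((2 : ℝ)⁻¹) • ((1 : Matrix (Fin n) (Fin n) ℝ) + U4))
        (-((2 : ℝ)⁻¹) • ((1 : Matrix (Fin n) (Fin n) ℝ) + U4.transpose))
        (U2 + U3)).PosSemidef) :
    ∀ X Y Z : Matrix (Fin n) (Fin n) ℝ, SDPFeasible A k X Y Z →
      Z.trace ≤ (⨆ i, ⨆ j, |U1 i j|) + k ^ 2 * (⨆ i, ⨆ j, |U2 i j|) +
        (∑ i, ∑ j, |U3 i j|) + k * (⨆ i, ⨆ j, |U4 i j|) := by
  rintro X Y Z ⟨-, -, hA, hX, hY, hY1, hZ, hP⟩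
  have h0 := aux_psd _ _ hdual hP
  have hW0 : (A.transpose * W * A * X).trace = 0 := by
    rw [Matrix.mul_assoc, Matrix.mul_assoc, Matrix.trace_mul_comm, Matrix.mul_assoc, hA,
      Matrix.mul_zero, Matrix.trace_zero]
  have h4 : (U4.transpose * Z.transpose).trace = (U4 * Z).trace := by
    rw [← Matrix.transpose_mul, Matrix.trace_transpose, Matrix.trace_mul_comm]
  rw [Matrix.fromBlocks_multiply, aux_tr] at h0
  simp only [Matrix.trace_add, Matrix.sub_mul, Matrix.add_mul, Matrix.trace_sub, hW0,
    Matrix.smul_mul, Matrix.trace_smul, Matrix.one_mul, h4, Matrix.trace_transpose,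
    smul_eq_mul] at h0
  have b1 := (abs_le.mp (aux_trace_le U1 X _ _ (aux_sup_nonneg U1) (aux_le_sup U1) hX)).2
  have b2 := (abs_le.mp (aux_trace_le U2 Y _ _ (aux_sup_nonneg U2) (aux_le_sup U2) hY1)).2
  have b3 := (abs_le.mp (aux_trace_le Y U3 1 _ zero_le_one hY le_rfl)).2
  rw [Matrix.trace_mul_comm] at b3
  have b4 := (abs_le.mp (aux_trace_le U4 Z _ _ (aux_sup_nonneg U4) (aux_le_sup U4) hZ)).1
  linarith
end

section
/- Let A ∈ ℝ^{m×n}, let k be an integer with 1 ≤ k ≤ n, let ε > 0, and let (X, Y, Z) be feasible for SDP_k. Define δ = 3 + 3(‖Z‖_F² + Tr(XY))/ε², g(X, δ) = (√(2/π) + √(2 log δ))·Σ_{i=1}^n (X_{ii})^{1/2}, and h(Y, n, k, δ) = max{ (√(2 log(2n)) + √(2 log δ))·max_{1≤i≤n} (Y_{ii})^{1/2}, (√(2/π) + √(2 log δ))·Σ_{i=1}^n (Y_{ii})^{1/2} / k }. Then α_k(A) ≥ (Tr(Z) − ε) / ( g(X, δ) · h(Y, n, k, δ) ). -/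
/-- The set of values whose supremum is `α_k(A)`. -/
def alphaSet {m n : ℕ} (A : Matrix (Fin m) (Fin n) ℝ) (k : ℕ) : Set ℝ :=
  {r : ℝ | ∃ (x : Fin n → ℝ) (T : Finset (Fin n)),
    A.mulVec x = 0 ∧ (∑ i, |x i|) ≤ 1 ∧ T.card = k ∧ r = ∑ i ∈ T, |x i|}

section Aux
open MeasureTheory ProbabilityTheory

lemma aux_abs_mgf (t : ℝ) (ht : 0 ≤ t) :
    ∫ x, Real.exp (t * |x|) ∂(gaussianReal 0 1) ≤ Real.exp (t * √(2 / Real.pi) + t ^ 2 / 2) := by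
  rw [integral_gaussianReal_eq_integral_smul (by simp)]
  have hφ : ∀ x, gaussianPDFReal 0 1 |x| = gaussianPDFReal 0 1 x := by
    intro x; simp [gaussianPDFReal]
  have h1 : ∫ x, gaussianPDFReal 0 1 x • Real.exp (t * |x|)
      = 2 * ∫ x in Set.Ioi (0:ℝ), gaussianPDFReal 0 1 x * Real.exp (t * x) := by
    rw [← integral_comp_abs (f := fun x => gaussianPDFReal 0 1 x * Real.exp (t * x))]
    simp [hφ]
  have h2 : ∀ x, gaussianPDFReal 0 1 x * Real.exp (t * x)
      = Real.exp (t ^ 2 / 2) * gaussianPDFReal 0 1 (x - t) := by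
    intro x
    simp only [gaussianPDFReal]
    rw [mul_assoc, ← Real.exp_add, mul_left_comm, ← Real.exp_add]
    congr 2
    simp; ring
  have h3 : ∫ x in Set.Ioi (0:ℝ), gaussianPDFReal 0 1 (x - t)
      = ∫ x in Set.Ioi (-t), gaussianPDFReal 0 1 x := by
    have := (measurePreserving_sub_right volume t).setIntegral_preimage_emb
      (measurableEmbedding_subRight t) (gaussianPDFReal 0 1) (Set.Ioi (-t))
    rw [← this]
    congr 2
    ext x; simp
  have hint := integrable_gaussianPDFReal 0 1
  have h4 : ∫ x in Set.Ioi (-t), gaussianPDFReal 0 1 x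
      = (∫ x in Set.Ioc (-t) 0, gaussianPDFReal 0 1 x)
        + ∫ x in Set.Ioi (0:ℝ), gaussianPDFReal 0 1 x := by
    rw [← setIntegral_union (by
      rw [Set.disjoint_left]; intro x hx; simp at hx ⊢; exact hx.2) measurableSet_Ioi
      hint.integrableOn hint.integrableOn, Set.Ioc_union_Ioi_eq_Ioi (by linarith)]
  have h5 : 2 * ∫ x in Set.Ioi (0:ℝ), gaussianPDFReal 0 1 x = 1 := by
    rw [← integral_comp_abs (f := gaussianPDFReal 0 1)]
    simp only [hφ]
    exact integral_gaussianPDFReal_eq_one 0 (by simp)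
  have h0 : 2 * gaussianPDFReal 0 1 0 = √(2 / Real.pi) := by
    have : (2:ℝ) = √4 := by rw [show (4:ℝ) = 2^2 by norm_num]; simp
    simp only [gaussianPDFReal]
    simp
    rw [← div_eq_inv_mul]
    have h2 := Real.sqrt_nonneg 2
    have h2' : √2 * √2 = 2 := Real.mul_self_sqrt (by norm_num)
    have : √2 ≠ 0 := by positivity
    have : √Real.pi ≠ 0 := by have := Real.pi_pos; positivity
    field_simp
    nlinarith
  have h6 : ∫ x in Set.Ioc (-t) 0, gaussianPDFReal 0 1 x ≤ t * gaussianPDFReal 0 1 0 := by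
    have := setIntegral_mono (s := Set.Ioc (-t) 0) (μ := volume) (f := gaussianPDFReal 0 1)
      (g := fun _ => gaussianPDFReal 0 1 0) hint.integrableOn
      (by simp) (by
        intro x; simp only [gaussianPDFReal]
        refine mul_le_mul_of_nonneg_left (Real.exp_le_exp.2 ?_) (by positivity)
        simp only [NNReal.coe_one, sub_zero]
        nlinarith [sq_nonneg x])
    refine this.trans ?_
    simp [ht]
  rw [h1]
  simp_rw [h2]
  rw [integral_const_mul, h3, h4, Real.exp_add]
  have h7 := Real.add_one_le_exp (t * √(2 / Real.pi))
  have h8 := Real.exp_pos (t^2/2)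
  have h9 : 2 * ((∫ x in Set.Ioc (-t) 0, gaussianPDFReal 0 1 x)
        + ∫ x in Set.Ioi (0:ℝ), gaussianPDFReal 0 1 x) ≤ Real.exp (t * √(2 / Real.pi)) := by
    rw [← h0] at *
    nlinarith
  nlinarith

lemma aux_int_abs (t : ℝ) : Integrable (fun x => Real.exp (t * |x|)) (gaussianReal 0 1) :=
  integrable_exp_mul_abs (integrable_exp_mul_gaussianReal t) (integrable_exp_mul_gaussianReal (-t))

lemma aux_m2 : MemLp (fun x : ℝ => x ^ 2) 2 (gaussianReal 0 1) := by
  have := (memLp_id_gaussianReal' (μ := 0) (v := 1) 4 (by simp))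
  have h := this.norm_rpow_div 2
  simp at h
  have e : (4 / 2 : ENNReal) = 2 := by
    rw [ENNReal.div_eq_inv_mul, show (4:ENNReal) = 2 * 2 by norm_num, ← mul_assoc, ENNReal.inv_mul_cancel (by simp) (by simp), one_mul]
  rwa [e] at h

lemma aux_fourth : Var[fun x => x ^ 2; gaussianReal 0 1] = 2 := by
  have m2 := aux_m2
  have e2 : ∫ x, x ^ 2 ∂(gaussianReal 0 1) = 1 := by
    have := variance_fun_id_gaussianReal (μ := 0) (v := 1)
    rw [variance_eq_integral measurable_id'.aemeasurable] at this
    simpa using this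
  have e4 : ∫ x, x ^ 4 ∂(gaussianReal 0 1) = 3 := by
    have : ∫ x, x ^ 4 ∂(gaussianReal 0 1)
      = iteratedDeriv 4 (mgf (fun x ↦ x) (gaussianReal 0 1)) 0 := by
      rw [iteratedDeriv_mgf_zero] <;> simp
    rw [this, mgf_fun_id_gaussianReal]
    have key : ∀ (p q : ℝ → ℝ), (∀ t, HasDerivAt p (q t) t) →
        deriv (fun t => p t * Real.exp (t^2/2)) = fun t => (q t + t * p t) * Real.exp (t^2/2) := by
      intro p q h
      ext t
      have : HasDerivAt (fun t : ℝ => Real.exp (t^2/2)) (Real.exp (t^2/2) * t) t := by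
        have := (((hasDerivAt_id t).pow 2).div_const 2).exp
        simpa using this
      rw [((h t).fun_mul this).deriv]; ring
    have e0 : (fun t : ℝ => Real.exp (0 * t + (1:NNReal) * t ^ 2 / 2))
        = fun t => 1 * Real.exp (t^2/2) := by ext t; simp
    rw [e0]
    simp only [iteratedDeriv_succ, iteratedDeriv_zero]
    rw [key (fun _ => 1) (fun _ => 0) (fun t => hasDerivAt_const t 1),
      key (fun t => 0 + t * 1) (fun _ => 1) (fun t => by simpa using hasDerivAt_id' t),
      key (fun t => 1 + t * (0 + t * 1)) (fun t => 2 * t)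
        (fun t => by
          have := ((hasDerivAt_id t).pow 2).const_add 1
          convert! this using 1
          · ext s; simp; ring
          · simp),
      key (fun t => 2 * t + t * (1 + t * (0 + t * 1))) (fun t => 3 + 3 * t ^ 2)
        (fun t => by
          have := ((hasDerivAt_id t).const_mul 3).add ((hasDerivAt_id t).pow 3)
          convert! this using 1
          · ext s; simp; ring
          · simp)]
    simp
  rw [variance_eq_sub m2]
  have : (fun x : ℝ => x ^ 2) ^ 2 = fun x => x ^ 4 := by ext x; simp; ring
  rw [this, e4, e2]; norm_num

noncomputable abbrev gPi (ι : Type) [Fintype ι] : Measure (ι → ℝ) :=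
  Measure.pi (fun _ : ι => gaussianReal 0 1)

lemma aux_law {ι : Type} [Fintype ι] (p : ι → ℝ) :
    (gPi ι).map (fun g => ∑ a, p a * g a) = gaussianReal 0 (∑ a, p a ^ 2).toNNReal := by
  have hi : iIndepFun (fun a (g : ι → ℝ) => p a * g a) (gPi ι) :=
    iIndepFun_pi (X := fun a x => p a * x) (fun a => by fun_prop)
  have hl : ∀ a, HasGaussianLaw (fun (g : ι → ℝ) => p a * g a) (gPi ι) := by
    intro a
    constructor
    have : (gPi ι).map (fun g => p a * g a) = (gaussianReal 0 1).map (fun x => p a * x) := by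
      rw [← (measurePreserving_eval (fun _ : ι => gaussianReal 0 1) a).map_eq,
        Measure.map_map (by fun_prop) (by fun_prop)]
      rfl
    rw [this, gaussianReal_map_const_mul]
    infer_instance
  have hs := (hi.hasGaussianLaw_fun_sum hl)
  have := hs.isGaussian_map.eq_gaussianReal
  have hm : Measurable (fun g : ι → ℝ => ∑ a, p a * g a) := by fun_prop
  rw [this, variance_id_map hm.aemeasurable, integral_map hm.aemeasurable (by fun_prop)]
  have hv := variance_sum_pi (μ := fun _ : ι => gaussianReal 0 1) (X := fun a x => p a * x)
    (fun a => (memLp_id_gaussianReal' 2 (by simp)).const_mul _)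
  congr 2
  · simp only [id]
    rw [integral_finsetSum _ (fun a _ => (hl a).integrable)]
    apply Finset.sum_eq_zero
    intro a _
    rw [integral_const_mul, show ∫ g, g a ∂(gPi ι) = ∫ x, x ∂(gaussianReal 0 1) from
      integral_comp_eval (μ := fun _ : ι => gaussianReal 0 1) (i := a) (f := fun x => x)
        (by fun_prop)]
    simp
  · rw [Finset.sum_fn] at hv
    rw [hv]
    congr with a
    rw [variance_const_mul]; simp

lemma aux_row {ι : Type} [Fintype ι] (p : ι → ℝ) (t : ℝ) (ht : 0 ≤ t) :
    Integrable (fun g : ι → ℝ => Real.exp (t * |(∑ a, p a * g a) / √(∑ a, p a ^ 2)|)) (gPi ι) ∧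
    ∫ g, Real.exp (t * |(∑ a, p a * g a) / √(∑ a, p a ^ 2)|) ∂(gPi ι)
      ≤ Real.exp (t * √(2 / Real.pi) + t ^ 2 / 2) := by
  set s := √(∑ a, p a ^ 2) with hs
  have hs0 : 0 ≤ s := Real.sqrt_nonneg _
  rcases hs0.eq_or_lt with h | h
  · rw [← h]
    simp
    positivity
  · have hsq : s ^ 2 = ∑ a, p a ^ 2 := Real.sq_sqrt (by positivity)
    have law := aux_law (fun a => p a / s)
    have e1 : ∑ a, (p a / s) ^ 2 = 1 := by
      simp_rw [div_pow]
      rw [← Finset.sum_div, ← hsq]; field_simp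
    have e2 : (fun g : ι → ℝ => ∑ a, p a / s * g a) = fun g => (∑ a, p a * g a) / s := by
      ext g; rw [Finset.sum_div]; congr with a; ring
    rw [e1, e2, Real.toNNReal_one] at law
    have hm : Measurable (fun g : ι → ℝ => (∑ a, p a * g a) / s) := by fun_prop
    have hb := aux_abs_mgf t ht
    have hi := aux_int_abs t
    rw [← law] at hb hi
    rw [integral_map hm.aemeasurable (by fun_prop)] at hb
    exact ⟨hi.comp_measurable hm, hb⟩

lemma aux_l1 {ι : Type} [Fintype ι] {n : ℕ} (P : Matrix (Fin n) ι ℝ) (t : ℝ) (ht : 0 ≤ t)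
    (hS : 0 < ∑ i, √(∑ a, P i a ^ 2)) :
    (gPi ι).real {g | (√(2 / Real.pi) + t) * ∑ i, √(∑ a, P i a ^ 2) ≤ ∑ i, |∑ a, P i a * g a|}
      ≤ Real.exp (-(t ^ 2 / 2)) := by
  set s : Fin n → ℝ := fun i => √(∑ a, P i a ^ 2) with hs
  set S := ∑ i, s i with hSd
  change 0 < S at hS
  have hs0 : ∀ i, 0 ≤ s i := fun i => Real.sqrt_nonneg _
  set L : (ι → ℝ) → ℝ := fun g => ∑ i, (s i / S) * |(∑ a, P i a * g a) / s i| with hL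
  have hLe : ∀ g, ∑ i, |∑ a, P i a * g a| = S * L g := by
    intro g
    rw [hL, Finset.mul_sum]
    congr with i
    rcases (hs0 i).eq_or_lt with h | h
    · have : ∑ a, P i a ^ 2 = 0 := by
        have h' := h.symm
        rwa [hs, Real.sqrt_eq_zero (by positivity)] at h'
      rw [Finset.sum_eq_zero_iff_of_nonneg (fun _ _ => by positivity)] at this
      have : ∀ a, P i a = 0 := fun a => by simpa using this a (Finset.mem_univ _)
      simp [this]
    · rw [abs_div, abs_of_pos h]; field_simp
  have hw : ∑ i, s i / S = 1 := by rw [← Finset.sum_div]; exact div_self hS.ne'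
  have hw0 : ∀ i, 0 ≤ s i / S := fun i => div_nonneg (hs0 i) hS.le
  have hcv : ∀ g, Real.exp (t * L g) ≤
      ∑ i, s i / S * Real.exp (t * |(∑ a, P i a * g a) / s i|) := by
    intro g
    have := convexOn_exp.map_sum_le (t := Finset.univ) (w := fun i => s i / S)
      (p := fun i => t * |(∑ a, P i a * g a) / s i|) (fun i _ => hw0 i) hw (by simp)
    simp only [smul_eq_mul] at this
    refine le_trans (le_of_eq ?_) this
    rw [hL, Finset.mul_sum]
    congr 1
    apply Finset.sum_congr rfl
    intro i _
    ring
  have hI : Integrable (fun g => ∑ i, s i / S * Real.exp (t * |(∑ a, P i a * g a) / s i|))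
      (gPi ι) :=
    integrable_finsetSum _ (fun i _ => (aux_row (P i) t ht).1.const_mul _)
  have hI2 : Integrable (fun g => Real.exp (t * L g)) (gPi ι) := by
    refine hI.mono' (by rw [hL]; exact Measurable.aestronglyMeasurable (by fun_prop))
      (Filter.Eventually.of_forall fun g => ?_)
    rw [Real.norm_eq_abs, abs_of_pos (Real.exp_pos _)]
    exact hcv g
  have hmgf : mgf L (gPi ι) t ≤ Real.exp (t * √(2 / Real.pi) + t ^ 2 / 2) := by
    rw [mgf]
    refine (integral_mono hI2 hI hcv).trans ?_
    rw [integral_finsetSum _ (fun i _ => (aux_row (P i) t ht).1.const_mul _)]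
    calc _ ≤ ∑ i, s i / S * Real.exp (t * √(2 / Real.pi) + t ^ 2 / 2) := by
          apply Finset.sum_le_sum
          intro i _
          rw [integral_const_mul]
          exact mul_le_mul_of_nonneg_left (aux_row (P i) t ht).2 (hw0 i)
      _ = _ := by rw [← Finset.sum_mul, hw, one_mul]
  have hc := measure_ge_le_exp_mul_mgf (μ := gPi ι) (X := L) (√(2 / Real.pi) + t) ht hI2
  have hset : {g : ι → ℝ | (√(2 / Real.pi) + t) * S ≤ ∑ i, |∑ a, P i a * g a|}
      = {g | √(2 / Real.pi) + t ≤ L g} := by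
    ext g
    simp only [Set.mem_ofPred_eq]
    rw [hLe, mul_comm S, mul_le_mul_iff_left₀ hS]
  rw [hset]
  refine hc.trans ((mul_le_mul_of_nonneg_left hmgf (Real.exp_pos _).le).trans ?_)
  rw [← Real.exp_add]
  apply Real.exp_le_exp.2
  apply le_of_eq; ring

lemma aux_tail1 {ι : Type} [Fintype ι] (p : ι → ℝ) (M c : ℝ) (hM : 0 < M) (hc : 0 ≤ c)
    (h : √(∑ a, p a ^ 2) ≤ M) :
    (gPi ι).real {g | M * c ≤ ∑ a, p a * g a} ≤ Real.exp (-(c ^ 2 / 2)) := by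
  have law := aux_law p
  have hm : Measurable (fun g : ι → ℝ => ∑ a, p a * g a) := by fun_prop
  have hI : Integrable (fun g : ι → ℝ => Real.exp (c / M * ∑ a, p a * g a)) (gPi ι) := by
    have := integrable_exp_mul_gaussianReal (μ := 0) (v := (∑ a, p a ^ 2).toNNReal) (c / M)
    rw [← law] at this
    exact this.comp_measurable hm
  have hmg := mgf_gaussianReal law (c / M)
  have hcc := measure_ge_le_exp_mul_mgf (μ := gPi ι) (M * c) (t := c / M) (by positivity) hI
  refine hcc.trans ?_
  rw [hmg, ← Real.exp_add]
  apply Real.exp_le_exp.2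
  rw [Real.coe_toNNReal _ (by positivity)]
  have h2 : ∑ a, p a ^ 2 ≤ M ^ 2 := (Real.sqrt_le_left hM.le).1 h
  have h3 : (∑ a, p a ^ 2) * (c / M) ^ 2 ≤ M ^ 2 * (c / M) ^ 2 := by gcongr
  have h4 : M ^ 2 * (c / M) ^ 2 = c ^ 2 := by field_simp
  have h5 : -(c / M) * (M * c) = - c ^ 2 := by field_simp
  rw [h5]
  linarith

lemma aux_linf {ι : Type} [Fintype ι] {n : ℕ} (hn : 1 ≤ n) (P : Matrix (Fin n) ι ℝ)
    (t M : ℝ) (ht : 0 ≤ t)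
    (hM : 0 < M) (h : ∀ i, √(∑ a, P i a ^ 2) ≤ M) :
    (gPi ι).real {g | ∃ i, (√(2 * Real.log (2 * n)) + t) * M ≤ |∑ a, P i a * g a|}
      ≤ Real.exp (-(t ^ 2 / 2)) := by
  set b := √(2 * Real.log (2 * n)) with hb
  have hb0 : 0 ≤ b := Real.sqrt_nonneg _
  have hn' : (1:ℝ) ≤ n := by exact_mod_cast hn
  have hb2 : b ^ 2 = 2 * Real.log (2 * n) :=
    Real.sq_sqrt (mul_nonneg (by norm_num) (Real.log_nonneg (by linarith)))
  have hset : {g : ι → ℝ | ∃ i, (b + t) * M ≤ |∑ a, P i a * g a|} =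
      ⋃ i, ({g | M * (b + t) ≤ ∑ a, P i a * g a} ∪ {g | M * (b + t) ≤ ∑ a, (-P i a) * g a}) := by
    ext g
    simp [le_abs, mul_comm M]
  rw [hset]
  refine (measureReal_iUnion_fintype_le _).trans ?_
  calc _ ≤ ∑ i : Fin n, (Real.exp (-((b + t) ^ 2 / 2)) + Real.exp (-((b + t) ^ 2 / 2))) := by
        apply Finset.sum_le_sum
        intro i _
        refine (measureReal_union_le _ _).trans (add_le_add ?_ ?_)
        · exact aux_tail1 (P i) M (b + t) hM (by positivity) (h i)
        · exact aux_tail1 (fun a => - P i a) M (b + t) hM (by positivity) (by simpa using h i)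
    _ = (2 * n) * Real.exp (-((b + t) ^ 2 / 2)) := by simp; ring
    _ ≤ (2 * n) * Real.exp (-(Real.log (2 * n)) + -(t ^ 2 / 2)) := by
        gcongr
        nlinarith [mul_nonneg hb0 ht]
    _ = _ := by
        rw [Real.exp_add, Real.exp_neg, Real.exp_log (by positivity)]
        field_simp

lemma aux_cantelli {Ω : Type} [MeasurableSpace Ω] (μ : Measure Ω) [IsProbabilityMeasure μ]
    (W : Ω → ℝ) (hW : MemLp W 2 μ) (V e : ℝ) (hV : 0 < V) (he : 0 < e) (hVar : Var[W; μ] ≤ V) :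
    μ.real {ω | W ω ≤ μ[W] - e} ≤ V / (V + e ^ 2) := by
  set m := μ[W] with hm
  set c := V / e with hc
  have hc0 : 0 < c := by positivity
  have hWi : Integrable W μ := hW.integrable (by norm_num)
  have hU : MemLp (fun ω => W ω - m) 2 μ := hW.sub (memLp_const m)
  have hU2 : Integrable (fun ω => (W ω - m) ^ 2) μ := hU.integrable_sq
  have hUi : Integrable (fun ω => W ω - m) μ := hU.integrable (by norm_num)
  have hf : (fun ω => (m - W ω + c) ^ 2)
      = fun ω => (W ω - m) ^ 2 - 2 * c * (W ω - m) + c ^ 2 := by ext ω; ring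
  have hint : Integrable (fun ω => (m - W ω + c) ^ 2) μ := by
    rw [hf]; exact (hU2.sub (hUi.const_mul _)).add (integrable_const _)
  have hval : ∫ ω, (m - W ω + c) ^ 2 ∂μ ≤ V + c ^ 2 := by
    have hI1 : Integrable (fun ω => (W ω - m) ^ 2 - 2 * c * (W ω - m)) μ :=
      hU2.sub (hUi.const_mul _)
    rw [hf, integral_add hI1 (integrable_const _),
      integral_sub hU2 (hUi.const_mul _), integral_const_mul, integral_sub hWi (integrable_const _)]
    rw [variance_eq_integral hW.aestronglyMeasurable.aemeasurable] at hVar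
    simp only [integral_const, probReal_univ, one_smul]
    rw [← hm, sub_self, mul_zero, sub_zero]
    linarith
  have hmk := mul_meas_ge_le_integral_of_nonneg (μ := μ)
    (Filter.Eventually.of_forall fun ω => sq_nonneg (m - W ω + c)) hint ((e + c) ^ 2)
  have hsub : μ.real {ω | W ω ≤ m - e} ≤ μ.real {ω | (e + c) ^ 2 ≤ (m - W ω + c) ^ 2} := by
    refine measureReal_mono (fun ω hω => ?_) (measure_ne_top _ _)
    simp only [Set.mem_ofPred_eq] at hω ⊢
    apply pow_le_pow_left₀ (by positivity)
    linarith
  have h1 : (e + c) ^ 2 * μ.real {ω | W ω ≤ m - e} ≤ V + c ^ 2 :=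
    (mul_le_mul_of_nonneg_left hsub (by positivity)).trans (hmk.trans hval)
  have h2 : V + c ^ 2 = (e + c) ^ 2 * (V / (V + e ^ 2)) := by
    rw [hc]; field_simp; ring
  rw [h2] at h1
  exact le_of_mul_le_mul_left h1 (by positivity)

lemma aux_quad {ι : Type} [Fintype ι] (d : ι → ℝ) :
    MemLp (fun g : ι → ℝ => ∑ a, d a * g a ^ 2) 2 (gPi ι) ∧
    ∫ g, ∑ a, d a * g a ^ 2 ∂(gPi ι) = ∑ a, d a ∧
    Var[fun g : ι → ℝ => ∑ a, d a * g a ^ 2; gPi ι] = 2 * ∑ a, d a ^ 2 := by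
  have hme : ∀ a, MemLp (fun g : ι → ℝ => d a * g a ^ 2) 2 (gPi ι) := fun a =>
    (aux_m2.comp_measurePreserving
      (measurePreserving_eval (fun _ : ι => gaussianReal 0 1) a)).const_mul (d a)
  refine ⟨memLp_finsetSum _ (fun a _ => hme a), ?_, ?_⟩
  · rw [integral_finsetSum _ (fun a _ => (hme a).integrable (by norm_num))]
    congr with a
    rw [integral_const_mul, show ∫ g, g a ^ 2 ∂(gPi ι) = ∫ x, x ^ 2 ∂(gaussianReal 0 1) from
      integral_comp_eval (μ := fun _ : ι => gaussianReal 0 1) (i := a) (f := fun x => x ^ 2)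
        (by fun_prop)]
    have := variance_fun_id_gaussianReal (μ := 0) (v := 1)
    rw [variance_eq_integral measurable_id'.aemeasurable] at this
    simp at this
    rw [this, mul_one]
  · have hv := variance_sum_pi (μ := fun _ : ι => gaussianReal 0 1) (X := fun a x => d a * x ^ 2)
      (fun a => aux_m2.const_mul _)
    rw [Finset.sum_fn] at hv
    rw [hv, Finset.mul_sum]
    congr with a
    rw [variance_const_mul, aux_fourth, mul_comm]

lemma aux_alpha {m n : ℕ} (A : Matrix (Fin m) (Fin n) ℝ) (k : ℕ) :
    BddAbove (alphaSet A k) := by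
  refine ⟨1, ?_⟩
  rintro r ⟨x, T, -, h, -, rfl⟩
  exact (Finset.sum_le_univ_sum_of_nonneg (fun i => abs_nonneg (x i))).trans h

lemma aux_alpha0 {m n : ℕ} (A : Matrix (Fin m) (Fin n) ℝ) (k : ℕ) :
    0 ≤ sSup (alphaSet A k) := by
  apply Real.sSup_nonneg
  rintro r ⟨x, T, -, -, -, rfl⟩
  positivity

lemma aux_det {m n : ℕ} (A : Matrix (Fin m) (Fin n) ℝ) (k : ℕ) (hk1 : 1 ≤ k) (hkn : k ≤ n)
    (x y : Fin n → ℝ) (G H : ℝ) (hG : 0 < G) (hH : 0 ≤ H) (hA : A.mulVec x = 0)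
    (hx : ∑ i, |x i| ≤ G) (hy : ∀ i, |y i| ≤ H) (hy1 : ∑ i, |y i| ≤ k * H) :
    ∑ i, y i * x i ≤ G * H * sSup (alphaSet A k) := by
  obtain ⟨T, hT, hmax⟩ := Finset.exists_max_image
    (Finset.powersetCard k (Finset.univ : Finset (Fin n))) (fun T => ∑ i ∈ T, |x i|)
    (Finset.powersetCard_nonempty.2 (by simpa using hkn))
  have hTc : T.card = k := (Finset.mem_powersetCard.1 hT).2
  have hTne : T.Nonempty := by rw [← Finset.card_pos]; omega
  obtain ⟨i0, hi0, hmin⟩ := Finset.exists_min_image T (fun i => |x i|) hTne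
  have hout : ∀ j, j ∉ T → |x j| ≤ |x i0| := by
    intro j hj
    have h1 : j ∉ T.erase i0 := fun h => hj (Finset.mem_of_mem_erase h)
    have := hmax (insert j (T.erase i0)) (by
      rw [Finset.mem_powersetCard]
      refine ⟨Finset.subset_univ _, ?_⟩
      rw [Finset.card_insert_of_notMem h1, Finset.card_erase_of_mem hi0]; omega)
    rw [Finset.sum_insert h1] at this
    have h2 := Finset.add_sum_erase T (fun i => |x i|) hi0
    linarith
  set τ := |x i0| with hτ
  have hτ0 : 0 ≤ τ := abs_nonneg _
  have hmain : ∑ i, y i * x i ≤ H * ∑ i ∈ T, |x i| := by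
    have h1 : ∀ i, y i * x i ≤ (if i ∈ T then H * (|x i| - τ) else 0) + τ * |y i| := by
      intro i
      have ha : y i * x i ≤ |y i| * |x i| := by rw [← abs_mul]; exact le_abs_self _
      have hb := abs_nonneg (y i)
      split_ifs with hi
      · have := hmin i hi
        nlinarith [hy i]
      · have := hout i hi
        nlinarith
    calc _ ≤ ∑ i, ((if i ∈ T then H * (|x i| - τ) else 0) + τ * |y i|) :=
          Finset.sum_le_sum fun i _ => h1 i
      _ = H * ∑ i ∈ T, |x i| - k * H * τ + τ * ∑ i, |y i| := by
          rw [Finset.sum_add_distrib, ← Finset.mul_sum, Finset.sum_ite_mem, Finset.univ_inter,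
            ← Finset.mul_sum, Finset.sum_sub_distrib]
          simp [hTc]; ring
      _ ≤ _ := by nlinarith
  have hmem : (∑ i ∈ T, |x i|) / G ∈ alphaSet A k := by
    refine ⟨fun i => x i / G, T, ?_, ?_, hTc, ?_⟩
    · have : (fun i => x i / G) = G⁻¹ • x := by ext i; simp [div_eq_inv_mul]
      rw [this, Matrix.mulVec_smul, hA, smul_zero]
    · simp_rw [abs_div, abs_of_pos hG]
      rw [← Finset.sum_div, div_le_one hG]; exact hx
    · simp_rw [abs_div, abs_of_pos hG]
      rw [← Finset.sum_div]
  have h3 := le_csSup (aux_alpha A k) hmem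
  rw [div_le_iff₀ hG] at h3
  calc _ ≤ _ := hmain
    _ ≤ H * (sSup (alphaSet A k) * G) := mul_le_mul_of_nonneg_left h3 hH
    _ = _ := by ring

lemma aux_factor {n : ℕ} (X Y Z : Matrix (Fin n) (Fin n) ℝ)
    (hM : (Matrix.fromBlocks X Z.transpose Z Y).PosSemidef) :
    ∃ (P Q : Matrix (Fin n) (Fin n ⊕ Fin n) ℝ) (d : Fin n ⊕ Fin n → ℝ),
      P * P.transpose = X ∧ Q * Q.transpose = Y ∧ Q * P.transpose = Z ∧
      (P.transpose * Q + Q.transpose * P) = (2:ℝ) • Matrix.diagonal d := by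
  obtain ⟨B, hB⟩ : ∃ B, Matrix.fromBlocks X Z.transpose Z Y = B.conjTranspose * B := by
    open scoped MatrixOrder in
    exact CStarAlgebra.nonneg_iff_eq_star_mul_self.1 hM.nonneg
  let P0 : Matrix (Fin n) (Fin n ⊕ Fin n) ℝ := fun i a => B a (Sum.inl i)
  let Q0 : Matrix (Fin n) (Fin n ⊕ Fin n) ℝ := fun i a => B a (Sum.inr i)
  have hX : P0 * P0.transpose = X := by
    ext i j
    have := congrFun (congrFun hB (Sum.inl i)) (Sum.inl j)
    rw [Matrix.fromBlocks_apply₁₁] at this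
    rw [this]; rfl
  have hY : Q0 * Q0.transpose = Y := by
    ext i j
    have := congrFun (congrFun hB (Sum.inr i)) (Sum.inr j)
    rw [Matrix.fromBlocks_apply₂₂] at this
    rw [this]; rfl
  have hZ : Q0 * P0.transpose = Z := by
    ext i j
    have := congrFun (congrFun hB (Sum.inr i)) (Sum.inl j)
    rw [Matrix.fromBlocks_apply₂₁] at this
    rw [this]; rfl
  let S := (1/2:ℝ) • (P0.transpose * Q0 + Q0.transpose * P0)
  have hS : S.IsHermitian := by
    rw [Matrix.IsHermitian, Matrix.conjTranspose_eq_transpose_of_trivial]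
    simp [S, Matrix.transpose_mul, add_comm]
  let U : Matrix (Fin n ⊕ Fin n) (Fin n ⊕ Fin n) ℝ := hS.eigenvectorUnitary
  have hU : U.transpose * U = 1 := by
    have := Unitary.coe_star_mul_self hS.eigenvectorUnitary
    rwa [Matrix.star_eq_conjTranspose, Matrix.conjTranspose_eq_transpose_of_trivial] at this
  have hU' : U * U.transpose = 1 := mul_eq_one_comm.1 hU
  have hd : S = U * Matrix.diagonal hS.eigenvalues * U.transpose := by
    have := hS.spectral_theorem
    rw [Unitary.conjStarAlgAut_apply, Matrix.star_eq_conjTranspose,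
      Matrix.conjTranspose_eq_transpose_of_trivial] at this
    exact this
  refine ⟨P0 * U, Q0 * U, hS.eigenvalues, ?_, ?_, ?_, ?_⟩
  · rw [Matrix.transpose_mul, Matrix.mul_assoc, ← Matrix.mul_assoc U, hU', Matrix.one_mul, hX]
  · rw [Matrix.transpose_mul, Matrix.mul_assoc, ← Matrix.mul_assoc U, hU', Matrix.one_mul, hY]
  · rw [Matrix.transpose_mul, Matrix.mul_assoc, ← Matrix.mul_assoc U, hU', Matrix.one_mul, hZ]
  · have h2 : P0.transpose * Q0 + Q0.transpose * P0 = (2:ℝ) • S := by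
      simp only [S, smul_smul]; norm_num
    have h3 : (P0 * U).transpose * (Q0 * U) + (Q0 * U).transpose * (P0 * U)
        = U.transpose * (P0.transpose * Q0 + Q0.transpose * P0) * U := by
      simp only [Matrix.transpose_mul, Matrix.mul_add, Matrix.add_mul, Matrix.mul_assoc]
    rw [h3, h2, Matrix.mul_smul, Matrix.smul_mul]
    congr 1
    conv_lhs => rw [hd]
    simp only [Matrix.mul_assoc]
    rw [hU, Matrix.mul_one, ← Matrix.mul_assoc, hU, Matrix.one_mul]

lemma aux_factor2 {n : ℕ} (X Y Z : Matrix (Fin n) (Fin n) ℝ) {ι : Type} [Fintype ι]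
    [DecidableEq ι] (P Q : Matrix (Fin n) ι ℝ) (d : ι → ℝ)
    (hX : P * P.transpose = X) (hY : Q * Q.transpose = Y) (hZ : Q * P.transpose = Z)
    (hd : (P.transpose * Q + Q.transpose * P) = (2:ℝ) • Matrix.diagonal d) :
    (∀ g : ι → ℝ, ∑ i, Q.mulVec g i * P.mulVec g i = ∑ a, d a * g a ^ 2) ∧
    ∑ a, d a = Z.trace ∧
    2 * ∑ a, d a ^ 2 ≤ (∑ i, ∑ j, Z i j ^ 2) + (X * Y).trace := by
  refine ⟨?_, ?_, ?_⟩
  · intro g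
    have h1 : ∀ (P Q : Matrix (Fin n) ι ℝ), ∑ i, Q.mulVec g i * P.mulVec g i
        = dotProduct g ((Q.transpose * P).mulVec g) := by
      intro P Q
      rw [← Matrix.mulVec_mulVec, Matrix.dotProduct_mulVec, Matrix.vecMul_transpose]; rfl
    have h2 := h1 P Q
    have h3 := h1 Q P
    have h4 : dotProduct g ((P.transpose * Q + Q.transpose * P).mulVec g)
        = 2 * ∑ a, d a * g a ^ 2 := by
      rw [hd, Matrix.smul_mulVec, dotProduct_smul, smul_eq_mul]
      congr 1
      simp only [dotProduct, Matrix.mulVec_diagonal]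
      congr with a; ring
    rw [Matrix.add_mulVec, dotProduct_add, ← h2, ← h3] at h4
    have h5 : ∑ i, P.mulVec g i * Q.mulVec g i = ∑ i, Q.mulVec g i * P.mulVec g i := by
      congr with i; ring
    linarith
  · have := congrArg Matrix.trace hd
    rw [Matrix.trace_add, Matrix.trace_smul, Matrix.trace_diagonal, Matrix.trace_mul_comm, hZ,
      ← Matrix.trace_transpose (Q.transpose * P), Matrix.transpose_mul, Matrix.transpose_transpose,
      Matrix.trace_mul_comm, hZ, smul_eq_mul] at this
    linarith
  · have h := congrArg (fun M => Matrix.trace (M * M)) hd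
    simp only [Matrix.smul_mul, Matrix.mul_smul, Matrix.diagonal_mul_diagonal, Matrix.trace_smul,
      Matrix.trace_diagonal, smul_eq_mul, Matrix.add_mul, Matrix.mul_add, Matrix.trace_add] at h
    have hZt : P * Q.transpose = Z.transpose := by rw [← hZ]; simp
    have t1 : (P.transpose * Q * (P.transpose * Q)).trace = (Z * Z).trace := by
      rw [Matrix.mul_assoc, Matrix.trace_mul_comm, ← hZ]; simp only [Matrix.mul_assoc]
    have t2 : (Q.transpose * P * (P.transpose * Q)).trace = (X * Y).trace := by
      rw [Matrix.mul_assoc, Matrix.trace_mul_comm, ← hX, ← hY]; simp only [Matrix.mul_assoc]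
    have t3 : (P.transpose * Q * (Q.transpose * P)).trace = (X * Y).trace := by
      rw [Matrix.trace_mul_comm, t2]
    have t4 : (Q.transpose * P * (Q.transpose * P)).trace = (Z * Z).trace := by
      rw [← Matrix.trace_transpose, ← t1]; simp only [Matrix.transpose_mul,Matrix.transpose_transpose]
    rw [t1, t2, t3, t4] at h
    have hzz : (Z * Z).trace ≤ ∑ i, ∑ j, Z i j ^ 2 := by
      have e1 : (Z * Z).trace = ∑ i, ∑ j, Z i j * Z j i := by simp [Matrix.trace, Matrix.mul_apply]
      have e2 : ∑ i, ∑ j, Z j i ^ 2 = ∑ i, ∑ j, Z i j ^ 2 := Finset.sum_comm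
      have e3 : ∑ i, ∑ j, Z i j * Z j i ≤ ∑ i, ∑ j, (Z i j ^ 2 / 2 + Z j i ^ 2 / 2) := by
        refine Finset.sum_le_sum fun i _ => Finset.sum_le_sum fun j _ => ?_
        nlinarith [sq_nonneg (Z i j - Z j i)]
      simp only [Finset.sum_add_distrib, ← Finset.sum_div] at e3
      rw [e1]; linarith
    have e : ∑ a, d a * d a = ∑ a, d a ^ 2 := by congr with a; ring
    rw [e] at h
    linarith

end Aux

open MeasureTheory ProbabilityTheory in
/-- For any `(X, Y, Z)` feasible for `SDP_k` and any `ε > 0`, setting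
`δ = 3 + 3(‖Z‖_F² + Tr(XY))/ε²`, `g = (√(2/π) + √(2 log δ))·Σ_i √(X_ii)` and
`h = max{(√(2 log 2n) + √(2 log δ))·max_i √(Y_ii), (√(2/π) + √(2 log δ))·(Σ_i √(Y_ii))/k}`,
one has `α_k(A) ≥ (Tr(Z) − ε)/(g·h)`. -/
theorem stmt13 {m n : ℕ} (A : Matrix (Fin m) (Fin n) ℝ) (k : ℕ) (hk1 : 1 ≤ k) (hkn : k ≤ n)
    (ε : ℝ) (hε : 0 < ε) (X Y Z : Matrix (Fin n) (Fin n) ℝ)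
    (hfeas : SDPFeasible A (k : ℝ) X Y Z) :
    ∀ δ g h : ℝ,
      δ = 3 + 3 * ((∑ i, ∑ j, Z i j ^ 2) + (X * Y).trace) / ε ^ 2 →
      g = (Real.sqrt (2 / Real.pi) + Real.sqrt (2 * Real.log δ)) * ∑ i, Real.sqrt (X i i) →
      h = max ((Real.sqrt (2 * Real.log (2 * n)) + Real.sqrt (2 * Real.log δ)) *
            ⨆ i, Real.sqrt (Y i i))
          ((Real.sqrt (2 / Real.pi) + Real.sqrt (2 * Real.log δ)) *
            (∑ i, Real.sqrt (Y i i)) / (k : ℝ)) →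
      (Z.trace - ε) / (g * h) ≤ sSup (alphaSet A k) := by
  intro δ g h hδ hg hh
  have hα := aux_alpha0 A k
  by_cases hgh : g * h = 0
  · rw [hgh, div_zero]; exact hα
  have hk0 : (0:ℝ) < k := by exact_mod_cast hk1
  have hMnn : 0 ≤ ⨆ i, √(Y i i) := Real.iSup_nonneg fun i => Real.sqrt_nonneg _
  have hg0 : 0 ≤ g := by rw [hg]; positivity
  have hh0 : 0 ≤ h := by
    rw [hh]; refine le_trans ?_ (le_max_right _ _); positivity
  have hgp : 0 < g := lt_of_le_of_ne hg0 (fun e => hgh (by rw [← e, zero_mul]))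
  have hhp : 0 < h := lt_of_le_of_ne hh0 (fun e => hgh (by rw [← e, mul_zero]))
  by_cases htr : Z.trace - ε ≤ 0
  · exact (div_nonpos_of_nonpos_of_nonneg htr (by positivity)).trans hα
  push Not at htr
  obtain ⟨-, -, hA, -, -, -, -, hM⟩ := hfeas
  obtain ⟨P, Q, d, hX, hY, hZ, hd⟩ := aux_factor X Y Z hM
  obtain ⟨hq, hdt, hdv⟩ := aux_factor2 X Y Z P Q d hX hY hZ hd
  have hXi : ∀ i, X i i = ∑ a, P i a ^ 2 := by
    intro i; rw [← hX]; simp only [Matrix.mul_apply, Matrix.transpose_apply, sq]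
  have hYi : ∀ i, Y i i = ∑ a, Q i a ^ 2 := by
    intro i; rw [← hY]; simp only [Matrix.mul_apply, Matrix.transpose_apply, sq]
  have hAP : A * P = 0 := by
    rw [← hX] at hA
    have : (A * P) * (A * P).conjTranspose = 0 := by
      rw [Matrix.conjTranspose_eq_transpose_of_trivial, Matrix.transpose_mul, ← hA]
      simp only [Matrix.mul_assoc]
    exact Matrix.self_mul_conjTranspose_eq_zero.1 this
  set V := (∑ i, ∑ j, Z i j ^ 2) + (X * Y).trace with hV
  have hdpos : 0 < ∑ a, d a ^ 2 := by
    refine lt_of_le_of_ne (by positivity) (fun e => ?_)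
    have e' := e.symm
    rw [Finset.sum_eq_zero_iff_of_nonneg (fun _ _ => by positivity)] at e'
    have : ∑ a, d a = 0 := Finset.sum_eq_zero fun a ha => by simpa using e' a ha
    linarith
  have hVpos : 0 < V := by linarith
  have hδ1 : 3 ≤ δ := by rw [hδ]; have : 0 ≤ 3 * V / ε ^ 2 := by positivity
                         linarith
  set t := √(2 * Real.log δ) with ht
  have ht0 : 0 ≤ t := Real.sqrt_nonneg _
  have ht2 : Real.exp (-(t ^ 2 / 2)) = 1 / δ := by
    rw [ht, Real.sq_sqrt (mul_nonneg (by norm_num) (Real.log_nonneg (by linarith))),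
      mul_div_cancel_left₀ _ (by norm_num), Real.exp_neg, Real.exp_log (by linarith), one_div]
  have hSX : 0 < ∑ i, √(X i i) := by
    refine lt_of_le_of_ne (by positivity) (fun e => ?_)
    rw [← e, mul_zero] at hg; linarith
  have hSY : 0 < ∑ i, √(Y i i) := by
    refine lt_of_le_of_ne (by positivity) (fun e => ?_)
    have e' := e.symm
    rw [Finset.sum_eq_zero_iff_of_nonneg (fun _ _ => by positivity)] at e'
    have e2 : ∀ i, √(Y i i) = 0 := fun i => e' i (Finset.mem_univ _)
    have e3 : ⨆ i, √(Y i i) = 0 := by simp only [e2, Real.iSup_const_zero]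
    rw [← e, e3] at hh
    simp at hh
    linarith
  have hle : ∀ i, √(Y i i) ≤ ⨆ i, √(Y i i) := fun i =>
    le_ciSup (f := fun i => √(Y i i)) (Set.finite_range _).bddAbove i
  have hMp : 0 < ⨆ i, √(Y i i) := by
    by_contra hcon
    have : ∑ i, √(Y i i) ≤ 0 := Finset.sum_nonpos fun i _ => by linarith [hle i]
    linarith
  have b1 := aux_l1 P t ht0 (by simpa only [← hXi] using hSX)
  have b2 := aux_l1 Q t ht0 (by simpa only [← hYi] using hSY)
  have b3 := aux_linf (le_trans hk1 hkn) Q t _ ht0 hMp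
    (fun i => by simpa only [← hYi] using hle i)
  simp only [← hXi, ← hYi, ht2] at b1 b2 b3
  obtain ⟨hqm, hqi, hqv⟩ := aux_quad d
  rw [div_le_iff₀ (by positivity)]
  refine le_of_forall_pos_le_add fun η hη => ?_
  have b4 := aux_cantelli (gPi (Fin n ⊕ Fin n)) _ hqm V (ε + η) hVpos (by linarith)
    (by rw [hqv]; exact hdv)
  rw [hqi, hdt] at b4
  have hsum : 1 / δ + 1 / δ + 1 / δ + V / (V + (ε + η) ^ 2) < 1 := by
    have e1 : 1 / δ + 1 / δ + 1 / δ = ε ^ 2 / (V + ε ^ 2) := by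
      rw [hδ]; field_simp; ring
    have e2 : V / (V + (ε + η) ^ 2) < V / (V + ε ^ 2) := by
      apply div_lt_div_of_pos_left hVpos (by positivity)
      nlinarith
    have e3 : ε ^ 2 / (V + ε ^ 2) + V / (V + ε ^ 2) = 1 := by field_simp; ring
    linarith
  obtain ⟨ω, hω⟩ : ∃ ω : Fin n ⊕ Fin n → ℝ,
      ω ∉ ({ω | (√(2 / Real.pi) + t) * ∑ i, √(X i i) ≤ ∑ i, |∑ a, P i a * ω a|} ∪
        {ω | (√(2 / Real.pi) + t) * ∑ i, √(Y i i) ≤ ∑ i, |∑ a, Q i a * ω a|} ∪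
        {ω | ∃ i, (√(2 * Real.log (2 * n)) + t) * (⨆ i, √(Y i i)) ≤ |∑ a, Q i a * ω a|} ∪
        {ω | ∑ a, d a * ω a ^ 2 ≤ Z.trace - (ε + η)} : Set (Fin n ⊕ Fin n → ℝ)) := by
    by_contra hcon
    push Not at hcon
    have hu := Set.eq_univ_of_forall hcon
    have h1 := probReal_univ (μ := gPi (Fin n ⊕ Fin n))
    rw [← hu] at h1
    have u1 := measureReal_union_le (μ := gPi (Fin n ⊕ Fin n))
      ({ω | (√(2 / Real.pi) + t) * ∑ i, √(X i i) ≤ ∑ i, |∑ a, P i a * ω a|} ∪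
        {ω | (√(2 / Real.pi) + t) * ∑ i, √(Y i i) ≤ ∑ i, |∑ a, Q i a * ω a|} ∪
        {ω | ∃ i, (√(2 * Real.log (2 * n)) + t) * (⨆ i, √(Y i i)) ≤ |∑ a, Q i a * ω a|})
      {ω | ∑ a, d a * ω a ^ 2 ≤ Z.trace - (ε + η)}
    have u2 := measureReal_union_le (μ := gPi (Fin n ⊕ Fin n))
      ({ω | (√(2 / Real.pi) + t) * ∑ i, √(X i i) ≤ ∑ i, |∑ a, P i a * ω a|} ∪
        {ω | (√(2 / Real.pi) + t) * ∑ i, √(Y i i) ≤ ∑ i, |∑ a, Q i a * ω a|})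
      {ω | ∃ i, (√(2 * Real.log (2 * n)) + t) * (⨆ i, √(Y i i)) ≤ |∑ a, Q i a * ω a|}
    have u3 := measureReal_union_le (μ := gPi (Fin n ⊕ Fin n))
      {ω | (√(2 / Real.pi) + t) * ∑ i, √(X i i) ≤ ∑ i, |∑ a, P i a * ω a|}
      {ω | (√(2 / Real.pi) + t) * ∑ i, √(Y i i) ≤ ∑ i, |∑ a, Q i a * ω a|}
    linarith
  simp only [Set.mem_union, Set.mem_ofPred_eq, not_or, not_exists, not_le] at hω
  obtain ⟨⟨⟨c1, c2⟩, c3⟩, c4⟩ := hω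
  rw [← hg] at c1
  rw [← hq] at c4
  have hfin := aux_det A k hk1 hkn (P.mulVec ω) (Q.mulVec ω) g h hgp hh0
    (by rw [Matrix.mulVec_mulVec, hAP, Matrix.zero_mulVec]) c1.le
    (fun i => (c3 i).le.trans (by rw [hh]; exact le_max_left _ _))
    (by
      refine c2.le.trans ?_
      have : (√(2 / Real.pi) + t) * (∑ i, √(Y i i)) / k ≤ h := by rw [hh]; exact le_max_right _ _
      rw [div_le_iff₀ hk0] at this
      linarith)
  rw [mul_comm (sSup _)]
  linarith
end

section
/- Let A ∈ ℝ^{m×n} with n ≥ 1. Then sup{ Tr(Z) : (X, Y, Z) feasible for SDP_k with k = 1 } = α₁(A). In particular, every triple (X, Y, Z) feasible for SDP_1 satisfies Tr(Z) ≤ α₁(A), i.e. the semidefinite relaxation is tight for k = 1. -/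
theorem aux_bdd {m n : ℕ} (A : Matrix (Fin m) (Fin n) ℝ) : BddAbove (alphaSet A 1) := by
  refine ⟨1, ?_⟩
  rintro r ⟨x, T, -, h1, -, rfl⟩
  exact (Finset.sum_le_univ_sum_of_nonneg (fun i => abs_nonneg (x i))).trans h1

theorem aux_hom {m n : ℕ} (A : Matrix (Fin m) (Fin n) ℝ) (z : Fin n → ℝ)
    (hz : A.mulVec z = 0) (i : Fin n) :
    |z i| ≤ sSup (alphaSet A 1) * ∑ j, |z j| := by
  have hle : |z i| ≤ ∑ j, |z j| :=
    Finset.single_le_sum (f := fun j => |z j|) (fun j _ => abs_nonneg _) (Finset.mem_univ i)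
  have h0 : 0 ≤ ∑ j, |z j| := Finset.sum_nonneg (fun j _ => abs_nonneg _)
  rcases h0.eq_or_lt with h | h
  · rw [← h] at hle ⊢
    simpa using hle
  · have hm : (∑ j, |z j|)⁻¹ * |z i| ∈ alphaSet A 1 := by
      refine ⟨(∑ j, |z j|)⁻¹ • z, {i}, ?_, ?_, by simp, ?_⟩
      · rw [Matrix.mulVec_smul, hz, smul_zero]
      · simp only [Pi.smul_apply, smul_eq_mul, abs_mul, ← Finset.mul_sum]
        rw [abs_of_pos (inv_pos.2 h), inv_mul_cancel₀ h.ne']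
      · simp only [Finset.sum_singleton, Pi.smul_apply, smul_eq_mul, abs_mul]
        rw [abs_of_pos (inv_pos.2 h)]
    have := le_csSup (aux_bdd A) hm
    rwa [inv_mul_eq_div, div_le_iff₀ h] at this

theorem aux_ker {m n : ℕ} (A : Matrix (Fin m) (Fin n) ℝ) (X Y Z : Matrix (Fin n) (Fin n) ℝ)
    (hX : A * X * A.transpose = 0)
    (hP : (Matrix.fromBlocks X Z.transpose Z Y).PosSemidef) (i : Fin n) :
    A.mulVec (Z i) = 0 := by
  ext a
  have h1 : dotProduct (star (Sum.elim (A a) (0 : Fin n → ℝ)))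
      ((Matrix.fromBlocks X Z.transpose Z Y).mulVec (Sum.elim (A a) 0)) = 0 := by
    have h2 := congrFun (congrFun hX a) a
    rw [Matrix.mul_assoc] at h2
    rw [Matrix.fromBlocks_mulVec]
    simp only [Matrix.mul_apply, Matrix.transpose_apply, Matrix.zero_apply] at h2
    simpa [dotProduct, Matrix.mulVec] using h2
  have h3 := (hP.dotProduct_mulVec_zero_iff _).1 h1
  have h4 := congrFun h3 (Sum.inr i)
  rw [Matrix.fromBlocks_mulVec] at h4
  simp [Matrix.mulVec] at h4
  simpa [Matrix.mulVec, dotProduct_comm] using h4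

theorem aux_le {m n : ℕ} (hn : 1 ≤ n) (A : Matrix (Fin m) (Fin n) ℝ)
    (X Y Z : Matrix (Fin n) (Fin n) ℝ) (h : SDPFeasible A 1 X Y Z) :
    Z.trace ≤ sSup (alphaSet A 1) := by
  obtain ⟨-, -, hX, -, -, -, hZ, hP⟩ := h
  have h0 : 0 ≤ sSup (alphaSet A 1) :=
    le_csSup (aux_bdd A) ⟨0, {⟨0, hn⟩}, by simp, by simp, by simp, by simp⟩
  calc Z.trace = ∑ i, Z i i := rfl
    _ ≤ ∑ i, sSup (alphaSet A 1) * ∑ j, |Z i j| := Finset.sum_le_sum fun i _ =>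
        (le_abs_self _).trans (aux_hom A (Z i) (aux_ker A X Y Z hX hP i) i)
    _ = sSup (alphaSet A 1) * ∑ i, ∑ j, |Z i j| := by rw [Finset.mul_sum]
    _ ≤ sSup (alphaSet A 1) * 1 := mul_le_mul_of_nonneg_left hZ h0
    _ = _ := mul_one _

theorem aux_sum {n : ℕ} (x y : Fin n → ℝ) (hx : ∑ i, |x i| ≤ 1) (hy : ∑ i, |y i| ≤ 1) :
    ∑ i, ∑ j, |Matrix.vecMulVec x y i j| ≤ 1 := by
  simp only [Matrix.vecMulVec_apply, abs_mul, ← Finset.mul_sum, ← Finset.sum_mul]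
  exact mul_le_one₀ hx (Finset.sum_nonneg fun j _ => abs_nonneg _) hy

theorem aux_mem {m n : ℕ} (A : Matrix (Fin m) (Fin n) ℝ) (r : ℝ) (hr : r ∈ alphaSet A 1) :
    ∃ X Y Z : Matrix (Fin n) (Fin n) ℝ, SDPFeasible A 1 X Y Z ∧ r = Z.trace := by
  obtain ⟨x, T, hx, h1, hT, rfl⟩ := hr
  obtain ⟨i, rfl⟩ := Finset.card_eq_one.1 hT
  obtain ⟨s, hs, hsx⟩ : ∃ s : ℝ, |s| = 1 ∧ s * x i = |x i| := by
    rcases le_total 0 (x i) with h | h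
    · exact ⟨1, by simp, by simp [abs_of_nonneg h]⟩
    · exact ⟨-1, by simp, by simp [abs_of_nonpos h]⟩
  have hy : ∑ j, |(Pi.single i s : Fin n → ℝ) j| ≤ 1 := by
    rw [Finset.sum_eq_single i] <;> simp +contextual [hs, Pi.single_apply]
  have hy1 : ∀ j, |(Pi.single i s : Fin n → ℝ) j| ≤ 1 := fun j =>
    (Finset.single_le_sum (f := fun j => |(Pi.single i s : Fin n → ℝ) j|)
      (fun j _ => abs_nonneg _) (Finset.mem_univ j)).trans hy
  refine ⟨Matrix.vecMulVec x x, Matrix.vecMulVec (Pi.single i s) (Pi.single i s),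
    Matrix.vecMulVec (Pi.single i s) x, ⟨?_, ?_, ?_, aux_sum _ _ h1 h1, ?_, ?_,
      aux_sum _ _ hy h1, ?_⟩, ?_⟩
  · exact Matrix.transpose_vecMulVec _ _
  · exact Matrix.transpose_vecMulVec _ _
  · rw [Matrix.mul_vecMulVec, hx]; simp
  · intro a b
    rw [Matrix.vecMulVec_apply, abs_mul]
    exact mul_le_one₀ (hy1 a) (abs_nonneg _) (hy1 b)
  · simpa using aux_sum _ _ hy hy
  · have := Matrix.posSemidef_vecMulVec_self_star (Sum.elim x (Pi.single i s : Fin n → ℝ))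
    convert this using 1
    ext (a | a) (b | b) <;> simp [Matrix.vecMulVec_apply, mul_comm]
  · rw [Matrix.trace_vecMulVec]
    simp [hsx]

/-- The semidefinite relaxation is tight for `k = 1`: the optimal value of `SDP_1` equals
`α₁(A)`, and every feasible triple satisfies `Tr(Z) ≤ α₁(A)`. -/
theorem stmt16 {m n : ℕ} (hn : 1 ≤ n) (A : Matrix (Fin m) (Fin n) ℝ) :
    sSup {r : ℝ | ∃ X Y Z : Matrix (Fin n) (Fin n) ℝ,
        SDPFeasible A 1 X Y Z ∧ r = Z.trace} = sSup (alphaSet A 1) ∧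
    ∀ X Y Z : Matrix (Fin n) (Fin n) ℝ, SDPFeasible A 1 X Y Z →
      Z.trace ≤ sSup (alphaSet A 1) := by
  refine ⟨le_antisymm ?_ ?_, aux_le hn A⟩
  · refine csSup_le ?_ ?_
    · obtain ⟨X, Y, Z, h⟩ := aux_mem A 0 ⟨0, {⟨0, hn⟩}, by simp, by simp, by simp, by simp⟩
      exact ⟨_, X, Y, Z, h⟩
    · rintro r ⟨X, Y, Z, h, rfl⟩
      exact aux_le hn A X Y Z h
  · refine csSup_le_csSup ⟨sSup (alphaSet A 1), ?_⟩
      ⟨0, 0, {⟨0, hn⟩}, by simp, by simp, by simp, by simp⟩ (fun r hr => aux_mem A r hr)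
    rintro r ⟨X, Y, Z, h, rfl⟩
    exact aux_le hn A X Y Z h
end

section
/- Let m ≥ 1, n = 2m, A ∈ ℝ^{m×n}, and let Q ∈ ℝ^{n×n} be a symmetric matrix with Q² = Q, Tr(Q) = m and AQ = 0 (an orthogonal projector onto an m-dimensional subspace of the nullspace of A). Set k = √n, X = Q/(n√m), Y = Q/√n, Z = Q/n, t_j = 1/√n and r_j = 1/n for j = 1,…,n. Then (X, Y, Z, r, t) satisfies all the constraints of the refined semidefinite relaxation: A X Aᵀ = 0, ‖X‖₁ ≤ 1, Σ_{i=1}^n |Y_{ij}| ≤ k·t_j and |Y_{ij}| ≤ t_j for all i,j, 𝟙ᵀt ≤ k, t ≤ 𝟙, Σ_{i=1}^n |Z_{ij}| ≤ k·r_j and |Z_{ij}| ≤ r_j for all i,j, 𝟙ᵀr ≤ 1, and the block matrix [[X, Zᵀ],[Z, Y]] is positive semidefinite; moreover Tr(Z) = 1/2. Hence the optimal value of the refined relaxation is at least 1/2 when n = 2m and k = √n. -/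
lemma psd_aux {n : ℕ} (Q : Matrix (Fin n) (Fin n) ℝ) (hsym : Q.IsSymm) (hproj : Q * Q = Q)
    (a d e : ℝ) (ha : 0 ≤ a) (he : 0 ≤ e) :
    (Matrix.fromBlocks (a • Q) ((a * d) • Q) ((a * d) • Q) ((a * d * d + e) • Q)).PosSemidef := by
  have h1 := (Matrix.posSemidef_conjTranspose_mul_self
    (Matrix.fromBlocks Q (d • Q) (0 : Matrix (Fin n) (Fin n) ℝ) (0 : Matrix (Fin n) (Fin n) ℝ))).smul ha
  have h2 := (Matrix.posSemidef_conjTranspose_mul_self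
    (Matrix.fromBlocks (0 : Matrix (Fin n) (Fin n) ℝ) (0 : Matrix (Fin n) (Fin n) ℝ)
      (0 : Matrix (Fin n) (Fin n) ℝ) Q)).smul he
  have h3 := h1.add h2
  have hT : Q.conjTranspose = Q := by
    rw [Matrix.conjTranspose_eq_transpose_of_trivial]; exact hsym
  convert h3 using 1
  simp only [Matrix.fromBlocks_conjTranspose, Matrix.fromBlocks_multiply, Matrix.fromBlocks_smul,
    Matrix.fromBlocks_add, Matrix.conjTranspose_smul, hT, Matrix.conjTranspose_zero,
    Matrix.smul_mul, Matrix.mul_smul, hproj, Matrix.zero_mul, Matrix.mul_zero, smul_smul,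
    add_zero, zero_add, smul_zero, star_trivial, ← add_smul, mul_assoc]

/-- Performance counter-example: let `n = 2m`, let `Q` be a symmetric projector with `Q² = Q`,
`Tr(Q) = m` and `AQ = 0`, and set `k = √n`, `X = Q/(n√m)`, `Y = Q/√n`, `Z = Q/n`,
`t_j = 1/√n`, `r_j = 1/n`. Then `(X, Y, Z, r, t)` satisfies all constraints of the refined
semidefinite relaxation and `Tr(Z) = 1/2`. -/
theorem stmt17 {m n : ℕ} (hm : 1 ≤ m) (hn : n = 2 * m)
    (A : Matrix (Fin m) (Fin n) ℝ) (Q : Matrix (Fin n) (Fin n) ℝ)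
    (hsym : Q.IsSymm) (hproj : Q * Q = Q) (htr : Q.trace = (m : ℝ)) (hAQ : A * Q = 0) :
    ∀ (k : ℝ) (X Y Z : Matrix (Fin n) (Fin n) ℝ) (t r : Fin n → ℝ),
      k = Real.sqrt n →
      X = (((n : ℝ) * Real.sqrt m)⁻¹) • Q →
      Y = ((Real.sqrt n)⁻¹) • Q →
      Z = ((n : ℝ)⁻¹) • Q →
      t = (fun _ => (Real.sqrt n)⁻¹) →
      r = (fun _ => (n : ℝ)⁻¹) →
      A * X * A.transpose = 0 ∧
      (∑ i, ∑ j, |X i j|) ≤ 1 ∧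
      (∀ j, (∑ i, |Y i j|) ≤ k * t j) ∧
      (∀ i j, |Y i j| ≤ t j) ∧
      (∑ j, t j) ≤ k ∧
      (∀ j, t j ≤ 1) ∧
      (∀ j, (∑ i, |Z i j|) ≤ k * r j) ∧
      (∀ i j, |Z i j| ≤ r j) ∧
      (∑ j, r j) ≤ 1 ∧
      (Matrix.fromBlocks X Z.transpose Z Y).PosSemidef ∧
      Z.trace = 1 / 2 := by
  intro k X Y Z t r hk hX hY hZ ht hr
  subst hk hX hY hZ ht hr
  have hm0 : (1 : ℝ) ≤ m := by exact_mod_cast hm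
  have hnm : (n : ℝ) = 2 * m := by rw [hn]; push_cast; ring
  have hn0 : (0 : ℝ) < n := by linarith
  have hsn : 0 < Real.sqrt n := Real.sqrt_pos.2 hn0
  have hsm : 0 < Real.sqrt m := Real.sqrt_pos.2 (by linarith)
  have hsnn : Real.sqrt n * Real.sqrt n = n := Real.mul_self_sqrt hn0.le
  have hsmn : Real.sqrt m ≤ Real.sqrt n := Real.sqrt_le_sqrt (by linarith)
  have hsn1 : 1 ≤ Real.sqrt n := Real.one_le_sqrt.2 (by linarith)
  have hcol : ∀ j, ∑ i, |Q i j| ^ 2 = Q j j := by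
    intro j
    have h := congrFun (congrFun hproj j) j
    rw [Matrix.mul_apply] at h
    rw [← h]
    refine Finset.sum_congr rfl fun i _ => ?_
    rw [sq_abs, hsym.apply i j]; ring
  have hle : ∀ i j, |Q i j| ^ 2 ≤ Q j j := by
    intro i j
    rw [← hcol j]
    exact Finset.single_le_sum (f := fun i => |Q i j| ^ 2) (fun _ _ => by positivity)
      (Finset.mem_univ i)
  have hd1 : ∀ j, Q j j ≤ 1 := by
    intro j
    have := hle j j
    rw [sq_abs] at this
    nlinarith
  have habs : ∀ i j, |Q i j| ≤ 1 := by
    intro i j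
    have h1 := hle i j
    have h2 := hd1 j
    nlinarith [abs_nonneg (Q i j)]
  have hcs : ∀ j, ∑ i, |Q i j| ≤ Real.sqrt n := by
    intro j
    apply Real.le_sqrt_of_sq_le
    have h := sq_sum_le_card_mul_sum_sq (s := Finset.univ) (f := fun i => |Q i j|)
    simp only [hcol, Finset.card_univ, Fintype.card_fin] at h
    nlinarith [hd1 j]
  have htot : ∑ i, ∑ j, |Q i j| ≤ n * Real.sqrt m := by
    have h := sq_sum_le_card_mul_sum_sq (s := (Finset.univ : Finset (Fin n × Fin n)))
      (f := fun p => |Q p.1 p.2|)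
    simp only [Fintype.sum_prod_type, Finset.card_univ, Fintype.card_prod, Fintype.card_fin] at h
    rw [Finset.sum_comm (f := fun i j => |Q i j| ^ 2)] at h
    simp only [hcol] at h
    have htr' : ∑ j, Q j j = m := htr
    rw [htr'] at h
    refine abs_le_of_sq_le_sq' ?_ (by positivity) |>.2
    rw [mul_pow, Real.sq_sqrt (by linarith)]
    push_cast at h
    linarith
  refine ⟨?_, ?_, ?_, ?_, ?_, ?_, ?_, ?_, ?_, ?_, ?_⟩
  · simp [hAQ]
  · simp only [Matrix.smul_apply, smul_eq_mul, abs_mul, ← Finset.mul_sum]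
    rw [abs_of_pos (by positivity), inv_mul_le_iff₀ (by positivity)]
    linarith
  · intro j
    simp only [Matrix.smul_apply, smul_eq_mul, abs_mul, ← Finset.mul_sum]
    rw [abs_of_pos (by positivity), mul_comm]
    exact mul_le_mul_of_nonneg_right (hcs j) (by positivity)
  · intro i j
    simp only [Matrix.smul_apply, smul_eq_mul, abs_mul]
    rw [abs_of_pos (by positivity)]
    exact mul_le_of_le_one_right (by positivity) (habs i j)
  · simp only [Finset.sum_const, Finset.card_univ, Fintype.card_fin, nsmul_eq_mul]
    rw [← div_eq_mul_inv, div_le_iff₀ hsn, hsnn]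
  · intro j
    exact inv_le_one_of_one_le₀ hsn1
  · intro j
    simp only [Matrix.smul_apply, smul_eq_mul, abs_mul, ← Finset.mul_sum]
    rw [abs_of_pos (by positivity), mul_comm]
    exact mul_le_mul_of_nonneg_right (hcs j) (by positivity)
  · intro i j
    simp only [Matrix.smul_apply, smul_eq_mul, abs_mul]
    rw [abs_of_pos (by positivity)]
    exact mul_le_of_le_one_right (by positivity) (habs i j)
  · simp only [Finset.sum_const, Finset.card_univ, Fintype.card_fin, nsmul_eq_mul]
    rw [mul_inv_cancel₀ hn0.ne']
  · have h := psd_aux Q hsym hproj (((n : ℝ) * Real.sqrt m)⁻¹) (Real.sqrt m)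
      ((Real.sqrt n)⁻¹ - Real.sqrt m / n) (by positivity) (by
        rw [sub_nonneg, div_le_iff₀ hn0, inv_mul_eq_div, le_div_iff₀ hsn]
        nlinarith)
    have e1 : ((n : ℝ) * Real.sqrt m)⁻¹ * Real.sqrt m = (n : ℝ)⁻¹ := by field_simp
    rw [e1] at h
    have e2 : (n : ℝ)⁻¹ * Real.sqrt m + ((Real.sqrt n)⁻¹ - Real.sqrt m / n) = (Real.sqrt n)⁻¹ := by
      ring
    rw [e2] at h
    rw [Matrix.transpose_smul, hsym.eq]
    exact h
  · rw [Matrix.trace_smul, htr, hnm, smul_eq_mul]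
    field_simp
end
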